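/- For every natural number n ≥ 1, all path components of the space C(S^{2n+1}, Γ_{n+1}⁺) of almost contact structures on S^{2n+1} are homeomorphic: any two path components, with their subspace topologies, are homeomorphic topological spaces. -/

import Mathlib

open Topology

/-- The unit sphere `S^m ⊆ ℝ^{m+1}` centered at the origin. -/
noncomputable def Sph (m : ℕ) : Set (EuclideanSpace ℝ (Fin (m + 1))) :=
  Metric.sphere (0 : EuclideanSpace ℝ (Fin (m + 1))) 1

/-- The north pole `N = (0, …, 0, 1) ∈ S^m`. -/
noncomputable def northPole (m : ℕ) : Sph m :=
  ⟨EuclideanSpace.single (Fin.last m) (1 : ℝ), by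
    simp [Sph, EuclideanSpace.norm_single]⟩

/-- The space `Γ_n` of orthogonal complex structures on `ℝ^{2n}`: real `(2n) × (2n)` matrices
`J` (with `Fin (2n)` identified with `Fin n ⊕ Fin n`) such that `Jᵀ * J = 1` and `J * J = -1`,
with the subspace topology. -/
def Gamma (n : ℕ) : Set (Matrix (Fin n ⊕ Fin n) (Fin n ⊕ Fin n) ℝ) :=
  {J | J.transpose * J = 1 ∧ J * J = -1}

/-- The standard complex structure `J₀` on `ℝ^{2n}`, given by the block matrix
`[[0, -1], [1, 0]]`. -/
def J0 (n : ℕ) : Matrix (Fin n ⊕ Fin n) (Fin n ⊕ Fin n) ℝ :=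
  Matrix.fromBlocks 0 (-1) 1 0

theorem J0_mem (n : ℕ) : J0 n ∈ Gamma n := by
  constructor
  · simp [J0, Matrix.fromBlocks_transpose, Matrix.fromBlocks_multiply, ← Matrix.fromBlocks_one]
  · have h : (-1 : Matrix (Fin n ⊕ Fin n) (Fin n ⊕ Fin n) ℝ)
        = Matrix.fromBlocks (-1) (-0) (-0) (-1) := by
      rw [← Matrix.fromBlocks_neg, Matrix.fromBlocks_one]
    simp [J0, Matrix.fromBlocks_multiply, h]

/-- `Γ_n⁺`: the path component of the standard complex structure `J₀` in `Γ_n`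
(the homogeneous space `SO(2n)/U(n)`). -/
noncomputable def GammaPlus (n : ℕ) : Set (Gamma n) :=
  pathComponent (⟨J0 n, J0_mem n⟩ : Gamma n)

/-- `Γ_n⁺` pointed at `J₀`. -/
noncomputable def J0plus (n : ℕ) : GammaPlus n :=
  ⟨⟨J0 n, J0_mem n⟩, mem_pathComponent_self _⟩

namespace AlmostContact

open Matrix unitInterval

set_option linter.unusedSectionVars false

section Basics

variable {X Z : Type} [TopologicalSpace X] [TopologicalSpace Z]
variable {ι κ : Type} [Fintype ι] [DecidableEq ι] [Fintype κ] [DecidableEq κ]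

theorem mul_inv_of_isUnit {A : Matrix ι ι ℂ} (h : IsUnit A) : A * A⁻¹ = 1 :=
  A.mul_nonsing_inv ((Matrix.isUnit_iff_isUnit_det A).1 h)

theorem inv_mul_of_isUnit {A : Matrix ι ι ℂ} (h : IsUnit A) : A⁻¹ * A = 1 :=
  A.nonsing_inv_mul ((Matrix.isUnit_iff_isUnit_det A).1 h)

theorem isUnit_inv_of_isUnit {A : Matrix ι ι ℂ} (h : IsUnit A) : IsUnit A⁻¹ :=
  (Matrix.isUnit_nonsing_inv_iff).2 h

theorem continuous_matrix_inv {u : Z → Matrix ι ι ℂ} (hu : Continuous u)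
    (h : ∀ z, IsUnit (u z)) : Continuous fun z => (u z)⁻¹ := by
  have hd : ∀ z, (u z).det ≠ 0 := fun z => ((Matrix.isUnit_iff_isUnit_det _).1 (h z)).ne_zero
  have : (fun z => (u z)⁻¹) = fun z => ((u z).det)⁻¹ • (u z).adjugate := by
    funext z
    rw [Matrix.inv_def, Ring.inverse_eq_inv']
  rw [this]
  exact (hu.matrix_det.inv₀ hd).smul hu.matrix_adjugate

/-- The block sum `A ⊕ 1`. -/
abbrev stab (κ : Type) [DecidableEq κ] (A : Matrix ι ι ℂ) : Matrix (ι ⊕ κ) (ι ⊕ κ) ℂ :=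
  fromBlocks A 0 0 1

theorem isUnit_blockDiag {A : Matrix ι ι ℂ} {B : Matrix κ κ ℂ} (hA : IsUnit A) (hB : IsUnit B) :
    IsUnit (fromBlocks A 0 0 B) :=
  Matrix.isUnit_fromBlocks_zero₂₁.2 ⟨hA, hB⟩

/-- Families of invertible matrices on `I × X` which are loops in the first variable and do not
depend on the second variable as long as it stays in `Y`. -/
structure Adm (Y : Set X) (u : I × X → Matrix ι ι ℂ) : Prop where
  cont : Continuous u
  unit : ∀ z, IsUnit (u z)
  const : ∀ t, ∀ y ∈ Y, ∀ y' ∈ Y, u (t, y) = u (t, y')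
  loop : ∀ x, u (0, x) = u (1, x)

namespace Adm

variable {Y : Set X} {u v : I × X → Matrix ι ι ℂ}

theorem mul (hu : Adm Y u) (hv : Adm Y v) : Adm Y (fun z => u z * v z) where
  cont := hu.cont.mul hv.cont
  unit z := (hu.unit z).mul (hv.unit z)
  const t y hy y' hy' := by rw [hu.const t y hy y' hy', hv.const t y hy y' hy']
  loop x := by rw [hu.loop, hv.loop]

theorem blockDiag {w : I × X → Matrix κ κ ℂ} (hu : Adm Y u) (hw : Adm Y w) :
    Adm Y (fun z => fromBlocks (u z) 0 0 (w z)) where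
  cont := hu.cont.matrix_fromBlocks continuous_const continuous_const hw.cont
  unit z := isUnit_blockDiag (hu.unit z) (hw.unit z)
  const t y hy y' hy' := by rw [hu.const t y hy y' hy', hw.const t y hy y' hy']
  loop x := by rw [hu.loop, hw.loop]

theorem one : Adm Y (fun _ => (1 : Matrix ι ι ℂ)) where
  cont := continuous_const
  unit _ := isUnit_one
  const _ _ _ _ _ := rfl
  loop _ := rfl

theorem stab (hu : Adm Y u) : Adm Y (fun z => stab κ (u z)) := hu.blockDiag one

theorem submatrix (hu : Adm Y u) (e : κ ≃ ι) : Adm Y (fun z => (u z).submatrix e e) where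
  cont := hu.cont.matrix_submatrix _ _
  unit z := (Matrix.isUnit_submatrix_equiv (A := u z) e e).2 (hu.unit z)
  const t y hy y' hy' := by rw [hu.const t y hy y' hy']
  loop x := by rw [hu.loop]

theorem ofLoop {α : I → Matrix ι ι ℂ} (hα : Continuous α) (h : ∀ t, IsUnit (α t))
    (h01 : α 0 = α 1) : Adm Y (fun z => α z.1) where
  cont := hα.comp continuous_fst
  unit _ := h _
  const _ _ _ _ _ := rfl
  loop _ := h01

theorem ofSpace {β : X → Matrix ι ι ℂ} (hβ : Continuous β) (h : ∀ x, IsUnit (β x))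
    (hY : ∀ y ∈ Y, ∀ y' ∈ Y, β y = β y') : Adm Y (fun z : I × X => β z.2) where
  cont := hβ.comp continuous_snd
  unit _ := h _
  const _ := hY
  loop _ := rfl

end Adm

/-- Homotopy through admissible families. -/
def Htpc (Y : Set X) (u v : I × X → Matrix ι ι ℂ) : Prop :=
  ∃ h : I × (I × X) → Matrix ι ι ℂ, Continuous h ∧ (∀ s, Adm Y (fun z => h (s, z))) ∧
    (∀ z, h (0, z) = u z) ∧ ∀ z, h (1, z) = v z

namespace Htpc

variable {Y : Set X} {u v w : I × X → Matrix ι ι ℂ}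

theorem refl (hu : Adm Y u) : Htpc Y u u :=
  ⟨fun p => u p.2, hu.cont.comp continuous_snd, fun _ => hu, fun _ => rfl, fun _ => rfl⟩

theorem adm_left (h : Htpc Y u v) : Adm Y u := by
  obtain ⟨h, _, ha, h0, _⟩ := h
  have := ha 0
  simpa only [h0] using this

theorem adm_right (h : Htpc Y u v) : Adm Y v := by
  obtain ⟨h, _, ha, _, h1⟩ := h
  have := ha 1
  simpa only [h1] using this

theorem homotopicWith (h : Htpc Y u v) :
    ContinuousMap.HomotopicWith (⟨u, h.adm_left.cont⟩ : C(I × X, Matrix ι ι ℂ))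
      ⟨v, h.adm_right.cont⟩ (fun f => Adm Y f) := by
  obtain ⟨h, hc, ha, h0, h1⟩ := h
  exact ⟨{ toFun := h, continuous_toFun := hc, map_zero_left := h0, map_one_left := h1,
           prop' := fun s => ha s }⟩

theorem trans (h₁ : Htpc Y u v) (h₂ : Htpc Y v w) : Htpc Y u w := by
  obtain ⟨H⟩ := h₁.homotopicWith.trans h₂.homotopicWith
  exact ⟨H, H.toHomotopy.continuous, fun s => H.prop' s, H.toHomotopy.map_zero_left,
    H.toHomotopy.map_one_left⟩

theorem mul {u' v' : I × X → Matrix ι ι ℂ} (h : Htpc Y u v) (h' : Htpc Y u' v') :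
    Htpc Y (fun z => u z * u' z) (fun z => v z * v' z) := by
  obtain ⟨h, hc, ha, h0, h1⟩ := h
  obtain ⟨k, kc, ka, k0, k1⟩ := h'
  exact ⟨fun p => h p * k p, hc.mul kc, fun s => (ha s).mul (ka s),
    fun z => by simp only [h0, k0], fun z => by simp only [h1, k1]⟩

theorem stab (h : Htpc Y u v) : Htpc Y (fun z => stab κ (u z)) (fun z => stab κ (v z)) := by
  obtain ⟨h, hc, ha, h0, h1⟩ := h
  exact ⟨fun p => AlmostContact.stab κ (h p),
    hc.matrix_fromBlocks continuous_const continuous_const continuous_const,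
    fun s => (ha s).stab, fun z => by simp only [h0], fun z => by simp only [h1]⟩

theorem submatrix (h : Htpc Y u v) (e : κ ≃ ι) :
    Htpc Y (fun z => (u z).submatrix e e) (fun z => (v z).submatrix e e) := by
  obtain ⟨h, hc, ha, h0, h1⟩ := h
  exact ⟨fun p => (h p).submatrix e e, hc.matrix_submatrix _ _,
    fun s => (ha s).submatrix e, fun z => by simp only [h0], fun z => by simp only [h1]⟩

end Htpc

/-- After stabilization, `u` is homotopic to a product `α t * β x`. -/
def Good (Y : Set X) (u : I × X → Matrix ι ι ℂ) : Prop :=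
  ∃ (κ : Type) (_ : Fintype κ) (_ : DecidableEq κ) (α : I → Matrix (ι ⊕ κ) (ι ⊕ κ) ℂ)
    (β : X → Matrix (ι ⊕ κ) (ι ⊕ κ) ℂ), Continuous α ∧ Continuous β ∧ (∀ t, IsUnit (α t)) ∧
    (∀ x, IsUnit (β x)) ∧ (∀ y ∈ Y, ∀ y' ∈ Y, β y = β y') ∧
    Htpc Y (fun z => stab κ (u z)) (fun z => α z.1 * β z.2)

theorem stab_mul (A B : Matrix ι ι ℂ) : stab κ (A * B) = stab κ A * stab κ B := by
  simp [fromBlocks_multiply]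

theorem stab_stab_submatrix {κ' : Type} [DecidableEq κ'] (A : Matrix ι ι ℂ) :
    (stab κ' (stab κ A)).submatrix (Equiv.sumAssoc ι κ κ').symm (Equiv.sumAssoc ι κ κ').symm
      = stab (κ ⊕ κ') A := by
  ext i j
  rcases i with i | i | i <;> rcases j with j | j | j <;> simp [stab, Matrix.one_apply]

namespace Good

variable {Y : Set X} {u v : I × X → Matrix ι ι ℂ}

theorem of_htpc (h : Htpc Y u v) (hv : Good Y v) : Good Y u := by
  obtain ⟨κ, _, _, α, β, hα, hβ, hα', hβ', hY, H⟩ := hv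
  exact ⟨κ, _, _, α, β, hα, hβ, hα', hβ', hY, h.stab.trans H⟩

theorem of_stab (h : Good Y (fun z => stab κ (u z))) : Good Y u := by
  obtain ⟨κ', _, _, α, β, hα, hβ, hα', hβ', hY, H⟩ := h
  let e := (Equiv.sumAssoc ι κ κ').symm
  refine ⟨κ ⊕ κ', inferInstance, inferInstance, fun t => (α t).submatrix e e,
    fun x => (β x).submatrix e e, hα.matrix_submatrix _ _, hβ.matrix_submatrix _ _,
    fun t => (Matrix.isUnit_submatrix_equiv e e).2 (hα' t),
    fun x => (Matrix.isUnit_submatrix_equiv e e).2 (hβ' x),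
    fun y hy y' hy' => by simp only [hY y hy y' hy'], ?_⟩
  have := H.submatrix e
  simpa only [e, stab_stab_submatrix, Matrix.submatrix_mul_equiv] using this

theorem mul_left {α : I → Matrix ι ι ℂ} (hα : Continuous α) (h : ∀ t, IsUnit (α t))
    (h01 : α 0 = α 1) (hu : Good Y u) : Good Y (fun z => α z.1 * u z) := by
  obtain ⟨κ, _, _, α', β, hα', hβ, hαu, hβu, hY, H⟩ := hu
  refine ⟨κ, _, _, fun t => stab κ (α t) * α' t, β,
    (hα.matrix_fromBlocks continuous_const continuous_const continuous_const).mul hα', hβ,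
    fun t => (isUnit_blockDiag (h t) isUnit_one).mul (hαu t), hβu, hY, ?_⟩
  have := (Htpc.refl (Adm.ofLoop (Y := Y) hα h h01).stab).mul H
  simpa only [stab_mul, mul_assoc] using this

theorem mul_right {β : X → Matrix ι ι ℂ} (hβ : Continuous β) (h : ∀ x, IsUnit (β x))
    (hY : ∀ y ∈ Y, ∀ y' ∈ Y, β y = β y') (hu : Good Y u) : Good Y (fun z => u z * β z.2) := by
  obtain ⟨κ, _, _, α', β', hα', hβ', hαu, hβu, hY', H⟩ := hu
  refine ⟨κ, _, _, α', fun x => β' x * stab κ (β x), hα', hβ'.mul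
    (hβ.matrix_fromBlocks continuous_const continuous_const continuous_const),
    hαu, fun t => (hβu t).mul (isUnit_blockDiag (h t) isUnit_one),
    fun y hy y' hy' => by simp only [hY y hy y' hy', hY' y hy y' hy'], ?_⟩
  have := H.mul (Htpc.refl (Adm.ofSpace (Y := Y) hβ h hY).stab)
  simpa only [stab_mul, mul_assoc] using this

end Good

/-- The block rotation matrix. -/
noncomputable def rot (ι : Type) [DecidableEq ι] (θ : ℝ) : Matrix (ι ⊕ ι) (ι ⊕ ι) ℂ :=
  fromBlocks ((Real.cos θ : ℂ) • 1) (-((Real.sin θ : ℂ) • 1)) ((Real.sin θ : ℂ) • 1)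
    ((Real.cos θ : ℂ) • 1)

theorem continuous_rot : Continuous (rot ι) := by
  unfold rot
  refine Continuous.matrix_fromBlocks ?_ ?_ ?_ ?_ <;> fun_prop

theorem rot_mul_rot_neg (θ : ℝ) : rot ι θ * rot ι (-θ) = 1 := by
  have h : (Real.cos θ : ℂ) * Real.cos θ + Real.sin θ * Real.sin θ = 1 := by
    exact_mod_cast (by nlinarith [Real.sin_sq_add_cos_sq θ] :
      Real.cos θ * Real.cos θ + Real.sin θ * Real.sin θ = 1)
  have h' : (Real.sin θ : ℂ) * Real.sin θ + Real.cos θ * Real.cos θ = 1 := by rw [add_comm, h]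
  rw [rot, rot, Real.cos_neg, Real.sin_neg, Complex.ofReal_neg]
  generalize (Real.cos θ : ℂ) = c at *
  generalize (Real.sin θ : ℂ) = s at *
  rw [fromBlocks_multiply, ← fromBlocks_one]
  congr 1
  · simp [smul_smul, ← add_smul, h]
  · simp [smul_smul, mul_comm]
  · simp [smul_smul, mul_comm]
  · simp [smul_smul, ← add_smul, h']

theorem rot_zero : rot ι 0 = 1 := by
  simp [rot]

theorem rot_pi_div_two_conj (A B : Matrix ι ι ℂ) :
    rot ι (Real.pi / 2) * fromBlocks A 0 0 B * rot ι (-(Real.pi / 2)) = fromBlocks B 0 0 A := by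
  simp [rot, fromBlocks_multiply]

theorem isUnit_rot (θ : ℝ) : IsUnit (rot ι θ) :=
  IsUnit.of_mul_eq_one _ (rot_mul_rot_neg θ)

theorem htpc_swap {Y : Set X} {u v : I × X → Matrix ι ι ℂ} (hu : Adm Y u) (hv : Adm Y v) :
    Htpc Y (fun z => fromBlocks (u z) 0 0 (v z)) (fun z => fromBlocks (v z) 0 0 (u z)) := by
  refine ⟨fun p => rot ι (p.1 * (Real.pi / 2)) * fromBlocks (u p.2) 0 0 (v p.2) *
    rot ι (-(p.1 * (Real.pi / 2))), ?_, ?_, ?_, ?_⟩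
  · have h1 : Continuous fun p : I × (I × X) => rot ι (p.1 * (Real.pi / 2)) :=
      continuous_rot.comp (by fun_prop)
    have h2 : Continuous fun p : I × (I × X) => rot ι (-(p.1 * (Real.pi / 2))) :=
      continuous_rot.comp (by fun_prop)
    have h3 : Continuous fun p : I × (I × X) => fromBlocks (u p.2) 0 0 (v p.2) :=
      (hu.blockDiag hv).cont.comp continuous_snd
    exact (h1.mul h3).mul h2
  · intro s
    have hc : ∀ θ, Adm Y (fun _ => rot ι θ) := fun θ =>
      Adm.ofLoop (Y := Y) (α := fun _ => rot ι θ) continuous_const (fun _ => isUnit_rot θ) rfl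
    exact ((hc (s * (Real.pi / 2))).mul (hu.blockDiag hv)).mul (hc (-(s * (Real.pi / 2))))
  · intro z
    simp [rot_zero]
  · intro z
    simpa using rot_pi_div_two_conj _ _

/-- A right factor depending only on `x` may be moved to the left. -/
theorem Good.mul_space_left {Y : Set X} {α : I → Matrix ι ι ℂ} (hα : Continuous α)
    (h : ∀ t, IsUnit (α t)) (h01 : α 0 = α 1) {β : X → Matrix ι ι ℂ} (hβ : Continuous β)
    (hu : ∀ x, IsUnit (β x)) (hY : ∀ y ∈ Y, ∀ y' ∈ Y, β y = β y') :
    Good Y (fun z => β z.2 * α z.1) := by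
  refine ⟨ι, inferInstance, inferInstance, fun t => stab ι (α t),
    fun x => fromBlocks 1 0 0 (β x),
    hα.matrix_fromBlocks continuous_const continuous_const continuous_const,
    continuous_const.matrix_fromBlocks continuous_const continuous_const hβ,
    fun t => isUnit_blockDiag (h t) isUnit_one, fun x => isUnit_blockDiag isUnit_one (hu x),
    fun y hy y' hy' => by simp only [hY y hy y' hy'], ?_⟩
  have := (htpc_swap (Adm.ofSpace hβ hu hY) Adm.one).mul
    (Htpc.refl (Adm.ofLoop (Y := Y) hα h h01).stab (u := fun z => stab ι (α z.1)))
  simpa [fromBlocks_multiply] using this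

end Basics

section Averaging

/-- The averaging operator over the two halves of a parameter. -/
noncomputable def halfAvg (f : ℝ → ℂ) : ℝ → ℂ := fun t => (f (t / 2) + f ((t + 1) / 2)) / 2

theorem continuous_halfAvg {f : ℝ → ℂ} (hf : Continuous f) : Continuous (halfAvg f) := by
  unfold halfAvg; fun_prop

theorem integral_halfAvg {f : ℝ → ℂ} (hf : Continuous f) :
    ∫ t in (0 : ℝ)..1, halfAvg f t = ∫ t in (0 : ℝ)..1, f t := by
  have hi : ∀ a b, IntervalIntegrable f MeasureTheory.volume a b :=
    fun a b => hf.intervalIntegrable a b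
  unfold halfAvg
  rw [intervalIntegral.integral_div, intervalIntegral.integral_add
    ((by fun_prop : Continuous fun t : ℝ => f (t / 2)).intervalIntegrable _ _)
    ((by fun_prop : Continuous fun t : ℝ => f ((t + 1) / 2)).intervalIntegrable _ _)]
  have h1 : ∫ t in (0 : ℝ)..1, f (t / 2) = (2 : ℝ) • ∫ t in (0 : ℝ)..(1 / 2), f t := by
    rw [intervalIntegral.integral_comp_div f two_ne_zero]; simp
  have h2 : ∫ t in (0 : ℝ)..1, f ((t + 1) / 2) = (2 : ℝ) • ∫ t in (1 / 2 : ℝ)..1, f t := by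
    have : ∀ t : ℝ, (t + 1) / 2 = t / 2 + 1 / 2 := fun t => by ring
    simp only [this]
    rw [intervalIntegral.integral_comp_div_add f two_ne_zero]; norm_num
  rw [h1, h2, ← smul_add, intervalIntegral.integral_add_adjacent_intervals (hi _ _) (hi _ _)]
  rw [Complex.real_smul]
  push_cast
  ring

theorem continuous_iterate_halfAvg (j : ℕ) {f : ℝ → ℂ} (hf : Continuous f) :
    Continuous (halfAvg^[j] f) := by
  induction j generalizing f with
  | zero => exact hf
  | succ j ih => exact ih (continuous_halfAvg hf)

theorem integral_iterate_halfAvg (j : ℕ) {f : ℝ → ℂ} (hf : Continuous f) :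
    ∫ t in (0 : ℝ)..1, halfAvg^[j] f t = ∫ t in (0 : ℝ)..1, f t := by
  induction j generalizing f with
  | zero => rfl
  | succ j ih =>
    rw [Function.iterate_succ_apply, ih (continuous_halfAvg hf), integral_halfAvg hf]

theorem norm_iterate_halfAvg_sub_le (j : ℕ) {ε : ℝ} {f : ℝ → ℂ}
    (hf : ∀ s ∈ Set.Icc (0 : ℝ) 1, ∀ t ∈ Set.Icc (0 : ℝ) 1, |s - t| ≤ (1 / 2) ^ j →
      ‖f s - f t‖ ≤ ε) :
    ∀ s ∈ Set.Icc (0 : ℝ) 1, ∀ t ∈ Set.Icc (0 : ℝ) 1,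
      ‖halfAvg^[j] f s - halfAvg^[j] f t‖ ≤ ε := by
  induction j generalizing f with
  | zero =>
    intro s hs t ht
    refine hf s hs t ht ?_
    rw [pow_zero, abs_le]
    constructor <;> linarith [hs.1, hs.2, ht.1, ht.2]
  | succ j ih =>
    rw [Function.iterate_succ_apply]
    refine ih fun s hs t ht hst => ?_
    have h1 : ‖f (s / 2) - f (t / 2)‖ ≤ ε := by
      refine hf _ ⟨by linarith [hs.1], by linarith [hs.2]⟩ _
        ⟨by linarith [ht.1], by linarith [ht.2]⟩ ?_
      rw [← sub_div, abs_div, pow_succ, abs_two]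
      linarith
    have h2 : ‖f ((s + 1) / 2) - f ((t + 1) / 2)‖ ≤ ε := by
      refine hf _ ⟨by linarith [hs.1], by linarith [hs.2]⟩ _
        ⟨by linarith [ht.1], by linarith [ht.2]⟩ ?_
      rw [← sub_div, abs_div, pow_succ, abs_two, add_sub_add_right_eq_sub]
      linarith
    have : halfAvg f s - halfAvg f t
        = ((f (s / 2) - f (t / 2)) + (f ((s + 1) / 2) - f ((t + 1) / 2))) / 2 := by
      unfold halfAvg; ring
    rw [this, norm_div, Complex.norm_two]
    linarith [norm_add_le (f (s / 2) - f (t / 2)) (f ((s + 1) / 2) - f ((t + 1) / 2))]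

theorem tendsto_iterate_halfAvg {f : ℝ → ℂ} (hf : Continuous f) :
    Filter.Tendsto (fun j => halfAvg^[j] f 0) Filter.atTop
      (𝓝 (∫ t in (0 : ℝ)..1, f t)) := by
  rw [Metric.tendsto_atTop]
  intro ε hε
  have huc := (isCompact_Icc (a := (0 : ℝ)) (b := 1)).uniformContinuousOn_of_continuous
    hf.continuousOn
  rw [Metric.uniformContinuousOn_iff] at huc
  obtain ⟨δ, hδ, hfδ⟩ := huc (ε / 2) (by linarith)
  obtain ⟨N, hN⟩ := exists_pow_lt_of_lt_one hδ (by norm_num : (1 / 2 : ℝ) < 1)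
  refine ⟨N, fun j hj => ?_⟩
  have hosc := norm_iterate_halfAvg_sub_le j (ε := ε / 2) (f := f) fun s hs t ht hst => by
    have := hfδ s hs t ht (by
      rw [Real.dist_eq]
      refine lt_of_le_of_lt (hst.trans ?_) hN
      exact pow_le_pow_of_le_one (by norm_num) (by norm_num) hj)
    rw [dist_eq_norm] at this
    exact this.le
  have hc := continuous_iterate_halfAvg j hf
  rw [← integral_iterate_halfAvg j hf, dist_eq_norm]
  have h0 : halfAvg^[j] f 0 = ∫ t in (0 : ℝ)..1, halfAvg^[j] f 0 := by simp
  rw [h0, ← intervalIntegral.integral_sub (by simp) (hc.intervalIntegrable _ _)]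
  have := intervalIntegral.norm_integral_le_of_norm_le_const (a := (0 : ℝ)) (b := 1)
    (C := ε / 2) (f := fun t => halfAvg^[j] f 0 - halfAvg^[j] f t) fun t ht => by
      rw [Set.uIoc_of_le zero_le_one] at ht
      exact hosc 0 ⟨le_rfl, zero_le_one⟩ t ⟨ht.1.le, ht.2⟩
  rw [sub_zero, abs_one, mul_one] at this
  linarith

end Averaging

section Spectral

variable {ι : Type} [Fintype ι] [DecidableEq ι]

/-- The standard parametrization of the unit circle. -/
noncomputable def circ (t : ℝ) : ℂ := Complex.exp (2 * Real.pi * Complex.I * t)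

theorem continuous_circ : Continuous circ := by unfold circ; fun_prop

theorem norm_circ (t : ℝ) : ‖circ t‖ = 1 := by
  have : (2 * Real.pi * Complex.I * t : ℂ) = ((2 * Real.pi * t : ℝ) : ℂ) * Complex.I := by
    push_cast; ring
  rw [circ, this, Complex.norm_exp_ofReal_mul_I]

theorem circ_ne_zero (t : ℝ) : circ t ≠ 0 := Complex.exp_ne_zero _

theorem circ_zero : circ 0 = 1 := by simp [circ]

theorem circ_one : circ 1 = 1 := by simp [circ]

theorem circ_half_sq (t : ℝ) : circ (t / 2) ^ 2 = circ t := by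
  rw [circ, circ, ← Complex.exp_nat_mul]
  congr 1; push_cast; ring

theorem circ_half_add (t : ℝ) : circ ((t + 1) / 2) = - circ (t / 2) := by
  have : (2 * Real.pi * Complex.I * (((t + 1) / 2 : ℝ) : ℂ) : ℂ)
      = 2 * Real.pi * Complex.I * ((t / 2 : ℝ) : ℂ) + Real.pi * Complex.I := by
    push_cast; ring
  rw [circ, this, Complex.exp_add, Complex.exp_pi_mul_I, circ]; ring

/-- The family of averages of the resolvent `(1 + a) (1 + a - z a)⁻¹` over roots of unity. -/
noncomputable def resAvg (a : Matrix ι ι ℂ) (j : ℕ) (z : ℂ) : Matrix ι ι ℂ :=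
  (1 + a) ^ 2 ^ j * ((1 + a) ^ 2 ^ j - z • a ^ 2 ^ j)⁻¹

/-- The spectral projection of the pencil `1 + a - z a`. -/
noncomputable def specProj (a : Matrix ι ι ℂ) : Matrix ι ι ℂ :=
  Matrix.of fun i k => ∫ t in (0 : ℝ)..1, resAvg a 0 (circ t) i k

theorem commute_one_add (a : Matrix ι ι ℂ) : Commute (1 + a) a :=
  (Commute.one_left a).add_left (Commute.refl a)

theorem commute_inv {a b : Matrix ι ι ℂ} (hb : IsUnit b) (h : Commute a b) : Commute a b⁻¹ := by
  have h1 := mul_inv_of_isUnit hb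
  have h2 := inv_mul_of_isUnit hb
  calc a * b⁻¹ = b⁻¹ * b * a * b⁻¹ := by rw [h2, one_mul]
    _ = b⁻¹ * a * (b * b⁻¹) := by rw [mul_assoc b⁻¹ b a, ← h.eq]; simp only [mul_assoc]
    _ = b⁻¹ * a := by rw [h1, mul_one]

variable {a : Matrix ι ι ℂ}

theorem isUnit_pow_sub (ha : ∀ z : ℂ, ‖z‖ = 1 → IsUnit (1 + a - z • a)) (j : ℕ) :
    ∀ z : ℂ, ‖z‖ = 1 → IsUnit ((1 + a) ^ 2 ^ j - z • a ^ 2 ^ j) := by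
  induction j with
  | zero => simpa using ha
  | succ j ih =>
    intro z hz
    obtain ⟨w, hw⟩ := IsAlgClosed.exists_pow_nat_eq z two_pos
    have hw1 : ‖w‖ = 1 := by
      rw [← hw, norm_pow] at hz
      nlinarith [norm_nonneg w]
    have h1 := ih w hw1
    have h2 := ih (-w) (by rwa [norm_neg])
    have hc : Commute ((1 + a) ^ 2 ^ j) (a ^ 2 ^ j) := (commute_one_add a).pow_pow _ _
    have : (1 + a) ^ 2 ^ (j + 1) - z • a ^ 2 ^ (j + 1)
        = ((1 + a) ^ 2 ^ j - w • a ^ 2 ^ j) * ((1 + a) ^ 2 ^ j - (-w) • a ^ 2 ^ j) := by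
      rw [pow_succ 2 j, pow_mul, pow_mul, sq, sq, ← hw]
      generalize (1 + a) ^ 2 ^ j = B at *
      generalize a ^ 2 ^ j = A at *
      simp only [sub_mul, mul_sub, neg_smul, smul_mul_assoc, mul_smul_comm, hc.eq, smul_smul,
        mul_neg, smul_sub, sq]
      abel
    rw [this]
    exact h1.mul h2

theorem resAvg_succ (ha : ∀ z : ℂ, ‖z‖ = 1 → IsUnit (1 + a - z • a)) (j : ℕ) (z : ℂ)
    (hz : ‖z‖ = 1) :
    resAvg a (j + 1) (z ^ 2) = resAvg a j z * resAvg a j (-z) ∧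
      (2 : ℂ) • resAvg a (j + 1) (z ^ 2) = resAvg a j z + resAvg a j (-z) := by
  have h1 := isUnit_pow_sub ha j z hz
  have h2 := isUnit_pow_sub ha j (-z) (by rwa [norm_neg])
  have h3 := isUnit_pow_sub ha (j + 1) (z ^ 2) (by rw [norm_pow, hz, one_pow])
  have hc : Commute ((1 + a) ^ 2 ^ j) (a ^ 2 ^ j) := (commute_one_add a).pow_pow _ _
  unfold resAvg
  rw [pow_succ 2 j, pow_mul, pow_mul] at *
  generalize (1 + a) ^ 2 ^ j = B at *
  generalize a ^ 2 ^ j = A at *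
  have hA1 : Commute B (B - z • A) := (Commute.refl B).sub_right (hc.smul_right z)
  have hA2 : Commute B (B - (-z) • A) := (Commute.refl B).sub_right (hc.smul_right _)
  have hfac : B ^ 2 - z ^ 2 • A ^ 2 = (B - z • A) * (B - (-z) • A) := by
    simp only [sub_mul, mul_sub, neg_smul, smul_mul_assoc, mul_smul_comm, hc.eq, smul_smul,
        mul_neg, smul_sub, sq]
    abel
  have h12 : Commute (B - z • A) (B - (-z) • A) :=
    hA2.sub_left (((hc.symm).sub_right ((Commute.refl A).smul_right _)).smul_left z)
  have hR : (B ^ 2 - z ^ 2 • A ^ 2)⁻¹ = (B - (-z) • A)⁻¹ * (B - z • A)⁻¹ := by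
    rw [hfac, Matrix.mul_inv_rev]
  have c1 := commute_inv h1 hA1
  have c2 := commute_inv h2 hA2
  have c12 : Commute (B - z • A)⁻¹ (B - (-z) • A)⁻¹ :=
    commute_inv h2 ((commute_inv h1 h12.symm).symm)
  rw [hR]
  generalize hR1 : (B - z • A)⁻¹ = R₁ at *
  generalize hR2 : (B - (-z) • A)⁻¹ = R₂ at *
  constructor
  · calc B ^ 2 * (R₂ * R₁) = B * (B * (R₁ * R₂)) := by rw [sq, c12.eq, mul_assoc]
      _ = B * R₁ * (B * R₂) := by
        rw [mul_assoc B R₁, ← mul_assoc R₁ B, ← c1.eq, mul_assoc B R₁ R₂]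
  · have e1 : (B - z • A) * R₁ = 1 := hR1 ▸ mul_inv_of_isUnit h1
    have e2 : R₂ * (B - (-z) • A) = 1 := hR2 ▸ inv_mul_of_isUnit h2
    have : R₁ + R₂ = R₂ * ((2 : ℂ) • B) * R₁ := by
      have hs : (2 : ℂ) • B = (B - z • A) + (B - (-z) • A) := by
        rw [two_smul, neg_smul]; abel
      rw [hs, mul_add, add_mul, e2, one_mul, mul_assoc, e1, mul_one, add_comm]
    rw [← mul_add, this, mul_smul_comm, smul_mul_assoc, mul_smul_comm, sq, ← c2.eq]
    simp only [mul_assoc]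

theorem continuous_resAvg_zero {X : Type} [TopologicalSpace X] {a : X → Matrix ι ι ℂ}
    (hc : Continuous a) (ha : ∀ x, ∀ z : ℂ, ‖z‖ = 1 → IsUnit (1 + a x - z • a x)) :
    Continuous fun p : X × ℝ => resAvg (a p.1) 0 (circ p.2) := by
  simp only [resAvg, pow_zero, pow_one]
  have h1 : Continuous fun p : X × ℝ => 1 + a p.1 :=
    continuous_const.add (hc.comp continuous_fst)
  refine h1.mul (continuous_matrix_inv (h1.sub ?_) fun p => ha _ _ (norm_circ _))
  exact (continuous_circ.comp continuous_snd).smul (hc.comp continuous_fst)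

theorem continuous_specProj {X : Type} [TopologicalSpace X] {a : X → Matrix ι ι ℂ}
    (hc : Continuous a) (ha : ∀ x, ∀ z : ℂ, ‖z‖ = 1 → IsUnit (1 + a x - z • a x)) :
    Continuous fun x => specProj (a x) := by
  refine continuous_matrix fun i k => ?_
  simp only [specProj, Matrix.of_apply]
  exact intervalIntegral.continuous_parametric_intervalIntegral_of_continuous'
    (f := fun x t => resAvg (a x) 0 (circ t) i k)
    ((continuous_resAvg_zero hc ha).matrix_elem i k) 0 1

theorem iterate_halfAvg_resAvg (ha : ∀ z : ℂ, ‖z‖ = 1 → IsUnit (1 + a - z • a)) (i k : ι)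
    (j : ℕ) : halfAvg^[j] (fun t => resAvg a 0 (circ t) i k) =
      fun t => resAvg a j (circ t) i k := by
  induction j with
  | zero => rfl
  | succ j ih =>
    rw [Function.iterate_succ_apply', ih]
    funext t
    have := (resAvg_succ ha j (circ (t / 2)) (norm_circ _)).2
    rw [circ_half_sq, ← circ_half_add] at this
    have := congr_fun (congr_fun this i) k
    simp only [Matrix.smul_apply, Matrix.add_apply, smul_eq_mul] at this
    rw [halfAvg, ← this]
    ring

theorem continuous_resAvg_circ (ha : ∀ z : ℂ, ‖z‖ = 1 → IsUnit (1 + a - z • a)) :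
    Continuous fun t : ℝ => resAvg a 0 (circ t) := by
  simp only [resAvg, pow_zero, pow_one]
  refine continuous_const.mul (continuous_matrix_inv (continuous_const.sub ?_)
    fun p => ha _ (norm_circ _))
  exact continuous_circ.smul continuous_const

theorem tendsto_resAvg (ha : ∀ z : ℂ, ‖z‖ = 1 → IsUnit (1 + a - z • a)) :
    Filter.Tendsto (fun j => resAvg a j 1) Filter.atTop (𝓝 (specProj a)) := by
  refine tendsto_pi_nhds.2 fun i => tendsto_pi_nhds.2 fun k => ?_
  have hcont : Continuous fun t : ℝ => resAvg a 0 (circ t) i k :=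
    (continuous_resAvg_circ ha).matrix_elem i k
  have := tendsto_iterate_halfAvg hcont
  simpa only [iterate_halfAvg_resAvg ha i k, circ_zero, specProj, Matrix.of_apply] using this

theorem specProj_mul_self (ha : ∀ z : ℂ, ‖z‖ = 1 → IsUnit (1 + a - z • a)) :
    specProj a * specProj a = specProj a := by
  have h := tendsto_resAvg ha
  have hs := (Filter.tendsto_add_atTop_iff_nat 1).2 h
  have h' : Filter.Tendsto (fun j => resAvg a j (-1)) Filter.atTop (𝓝 (specProj a)) := by
    have := (hs.const_smul (2 : ℂ)).sub h
    rw [two_smul, add_sub_cancel_right] at this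
    refine this.congr fun j => ?_
    have := (resAvg_succ ha j 1 (by simp)).2
    rw [one_pow] at this
    rw [this, add_sub_cancel_left]
  refine tendsto_nhds_unique ((h.mul h').congr fun j => ?_) hs
  have := (resAvg_succ ha j 1 (by simp)).1
  rw [one_pow] at this
  exact this.symm

theorem commute_specProj (ha : ∀ z : ℂ, ‖z‖ = 1 → IsUnit (1 + a - z • a)) :
    a * specProj a = specProj a * a := by
  have h := tendsto_resAvg ha
  refine tendsto_nhds_unique (tendsto_const_nhds.mul h) ((h.mul tendsto_const_nhds).congr
    fun j => ?_)
  have h1 : Commute a ((1 + a) ^ 2 ^ j) := (commute_one_add a).symm.pow_right _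
  have h2 : Commute a (a ^ 2 ^ j) := (Commute.refl a).pow_right _
  exact ((h1.mul_right (commute_inv (isUnit_pow_sub ha j 1 (by simp))
    (h1.sub_right (h2.smul_right _)))).eq).symm

theorem pow_mulVec {A : Matrix ι ι ℂ} {v : ι → ℂ} {c : ℂ} (h : A *ᵥ v = c • v) (k : ℕ) :
    A ^ k *ᵥ v = c ^ k • v := by
  induction k with
  | zero => simp
  | succ k ih =>
    rw [pow_succ, ← Matrix.mulVec_mulVec, h, Matrix.mulVec_smul, ih, smul_smul, pow_succ,
      mul_comm]

theorem resAvg_mulVec (ha : ∀ z : ℂ, ‖z‖ = 1 → IsUnit (1 + a - z • a)) {v : ι → ℂ} {c : ℂ}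
    (h : a *ᵥ v = c • v) (j : ℕ) :
    ((1 + c) ^ 2 ^ j - c ^ 2 ^ j) • (resAvg a j 1 *ᵥ v) = (1 + c) ^ 2 ^ j • v := by
  have h1 : (1 + a) *ᵥ v = (1 + c) • v := by
    rw [Matrix.add_mulVec, h, Matrix.one_mulVec, add_smul, one_smul]
  have hb := pow_mulVec h1 (2 ^ j)
  have hd : ((1 + a) ^ 2 ^ j - (1 : ℂ) • a ^ 2 ^ j) *ᵥ v
      = ((1 + c) ^ 2 ^ j - c ^ 2 ^ j) • v := by
    rw [one_smul, Matrix.sub_mulVec, hb, pow_mulVec h, sub_smul]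
  rw [← Matrix.mulVec_smul, ← hd, Matrix.mulVec_mulVec, resAvg, mul_assoc,
    inv_mul_of_isUnit (isUnit_pow_sub ha j 1 (by simp)), mul_one, hb]

theorem tendsto_pow_two_pow {r : ℂ} (hr : ‖r‖ < 1) :
    Filter.Tendsto (fun j : ℕ => r ^ 2 ^ j) Filter.atTop (𝓝 0) :=
  (tendsto_pow_atTop_nhds_zero_of_norm_lt_one hr).comp
    (Filter.tendsto_atTop_mono (fun j => j.lt_two_pow_self.le) Filter.tendsto_id)

theorem tendsto_resAvg_mulVec (ha : ∀ z : ℂ, ‖z‖ = 1 → IsUnit (1 + a - z • a)) (v : ι → ℂ) :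
    Filter.Tendsto (fun j => resAvg a j 1 *ᵥ v) Filter.atTop (𝓝 (specProj a *ᵥ v)) :=
  ((by fun_prop : Continuous fun A : Matrix ι ι ℂ => A *ᵥ v).tendsto _).comp (tendsto_resAvg ha)

theorem specProj_mulVec_of_lt (ha : ∀ z : ℂ, ‖z‖ = 1 → IsUnit (1 + a - z • a)) {v : ι → ℂ}
    {c : ℂ} (h : a *ᵥ v = c • v) (hc : ‖c‖ < ‖1 + c‖) : specProj a *ᵥ v = v := by
  have h0 : 1 + c ≠ 0 := fun h0 => by
    rw [h0, norm_zero] at hc; exact absurd hc (norm_nonneg c).not_gt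
  have hr : ‖c / (1 + c)‖ < 1 := by
    rw [norm_div]; exact (div_lt_one (norm_pos_iff.2 h0)).2 hc
  have := ((tendsto_const_nhds (x := (1 : ℂ))).sub (tendsto_pow_two_pow hr)).smul
    (tendsto_resAvg_mulVec ha v)
  rw [sub_zero, one_smul] at this
  refine tendsto_nhds_unique this (tendsto_const_nhds.congr fun j => ?_)
  have hj := resAvg_mulVec ha h j
  have h0j : (1 + c) ^ 2 ^ j ≠ 0 := pow_ne_zero _ h0
  have : (1 - (c / (1 + c)) ^ 2 ^ j) = ((1 + c) ^ 2 ^ j)⁻¹ * ((1 + c) ^ 2 ^ j - c ^ 2 ^ j) := by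
    rw [div_pow]; field_simp
  rw [this, mul_smul, hj, smul_smul, inv_mul_cancel₀ h0j, one_smul]

theorem specProj_mulVec_of_gt (ha : ∀ z : ℂ, ‖z‖ = 1 → IsUnit (1 + a - z • a)) {v : ι → ℂ}
    {c : ℂ} (h : a *ᵥ v = c • v) (hc : ‖1 + c‖ < ‖c‖) : specProj a *ᵥ v = 0 := by
  have h0 : c ≠ 0 := fun h0 => by
    rw [h0, norm_zero] at hc; exact absurd hc (norm_nonneg _).not_gt
  have hr : ‖(1 + c) / c‖ < 1 := by
    rw [norm_div]; exact (div_lt_one (norm_pos_iff.2 h0)).2 hc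
  have h1 := ((tendsto_const_nhds (x := (1 : ℂ))).sub (tendsto_pow_two_pow hr)).smul
    (tendsto_resAvg_mulVec ha v)
  have h2 := ((tendsto_pow_two_pow hr).neg).smul (tendsto_const_nhds (x := v))
  rw [sub_zero, one_smul] at h1
  rw [neg_zero, zero_smul] at h2
  refine tendsto_nhds_unique h1 (h2.congr fun j => ?_)
  have hj := resAvg_mulVec ha h j
  have h0j : c ^ 2 ^ j ≠ 0 := pow_ne_zero _ h0
  have e1 : (1 - ((1 + c) / c) ^ 2 ^ j)
      = -(c ^ 2 ^ j)⁻¹ * ((1 + c) ^ 2 ^ j - c ^ 2 ^ j) := by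
    rw [div_pow]; field_simp; ring
  rw [e1, mul_smul, hj, smul_smul, div_pow]
  congr 1
  field_simp

/-- The deformation of the pencil to its spectral normal form stays invertible. -/
theorem isUnit_pencil_deform (ha : ∀ z : ℂ, ‖z‖ = 1 → IsUnit (1 + a - z • a)) {s : ℝ}
    (hs : s ∈ Set.Icc (0 : ℝ) 1) {z : ℂ} (hz : ‖z‖ = 1) :
    IsUnit ((1 + a - ((s : ℂ) * z) • a) * specProj a
      + ((s : ℂ) • (1 + a) - z • a) * (1 - specProj a)) := by
  rcases hs.2.eq_or_lt with h1 | hs1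
  · subst h1
    have : (1 + a - (((1 : ℝ) : ℂ) * z) • a) * specProj a
      + ((((1 : ℝ) : ℂ) • (1 + a) - z • a) * (1 - specProj a)) = 1 + a - z • a := by
      simp [mul_sub]
    rw [this]
    exact ha z hz
  have hPP := specProj_mul_self ha
  have hcomm := commute_specProj ha
  rw [Matrix.isUnit_iff_isUnit_det, isUnit_iff_ne_zero, ne_eq, ← Matrix.exists_mulVec_eq_zero_iff]
  rintro ⟨v, hv0, hv⟩
  set P := specProj a with hP
  have hsn : ‖(s : ℂ)‖ = s := by rw [Complex.norm_real, Real.norm_of_nonneg hs.1]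
  have k1 : P * ((1 + a - ((s : ℂ) * z) • a) * P + ((s : ℂ) • (1 + a) - z • a) * (1 - P))
      = (1 + a - ((s : ℂ) * z) • a) * P := by
    have e1 : P * (1 + a - ((s : ℂ) * z) • a) = (1 + a - ((s : ℂ) * z) • a) * P := by
      simp only [mul_sub, sub_mul, mul_add, add_mul, mul_smul_comm, smul_mul_assoc, hcomm,
        mul_one, one_mul]
    have e2 : P * ((s : ℂ) • (1 + a) - z • a) = ((s : ℂ) • (1 + a) - z • a) * P := by
      simp only [mul_sub, sub_mul, mul_add, add_mul, mul_smul_comm, smul_mul_assoc, hcomm,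
        mul_one, one_mul]
    rw [mul_add, ← mul_assoc, ← mul_assoc, e1, e2, mul_assoc, hPP, mul_assoc, mul_sub P, hPP,
      mul_one, sub_self, mul_zero, add_zero]
  have hw : (1 + a - ((s : ℂ) * z) • a) *ᵥ (P *ᵥ v) = 0 := by
    rw [Matrix.mulVec_mulVec, ← k1, ← Matrix.mulVec_mulVec, hv, Matrix.mulVec_zero]
  have hw' : ((s : ℂ) • (1 + a) - z • a) *ᵥ ((1 - P) *ᵥ v) = 0 := by
    rw [Matrix.add_mulVec, ← Matrix.mulVec_mulVec, hw, zero_add] at hv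
    rw [Matrix.mulVec_mulVec, hv]
  have hPw : P *ᵥ (P *ᵥ v) = P *ᵥ v := by rw [Matrix.mulVec_mulVec, hPP]
  have hPw' : P *ᵥ ((1 - P) *ᵥ v) = 0 := by
    rw [Matrix.mulVec_mulVec, mul_sub, hPP, mul_one, sub_self, Matrix.zero_mulVec]
  have hsum : v = P *ᵥ v + (1 - P) *ᵥ v := by
    rw [← Matrix.add_mulVec, add_sub_cancel, Matrix.one_mulVec]
  generalize P *ᵥ v = w at *
  generalize (1 - P) *ᵥ v = w' at *
  have hz0 : z ≠ 0 := fun h => by simp [h] at hz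
  have hw0 : w = 0 := by
    have hne : (s : ℂ) * z - 1 ≠ 0 := fun h => by
      have : ‖(s : ℂ) * z‖ = 1 := by rw [sub_eq_zero.1 h, norm_one]
      rw [norm_mul, hsn, hz, mul_one] at this
      exact hs1.ne this
    have hev : a *ᵥ w = ((s : ℂ) * z - 1)⁻¹ • w := by
      rw [eq_inv_smul_iff₀ hne, sub_smul, one_smul, sub_eq_iff_eq_add]
      rw [Matrix.sub_mulVec, Matrix.add_mulVec, Matrix.one_mulVec, Matrix.smul_mulVec,
        sub_eq_zero] at hw
      exact hw.symm
    have := specProj_mulVec_of_gt ha hev (by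
      have : 1 + ((s : ℂ) * z - 1)⁻¹ = s * z * ((s : ℂ) * z - 1)⁻¹ := by field_simp; ring
      rw [this, norm_mul, norm_mul, hsn, hz, mul_one]
      exact mul_lt_of_lt_one_left (norm_pos_iff.2 (inv_ne_zero hne)) hs1)
    exact hPw.symm.trans this
  have hw0' : w' = 0 := by
    have hne : z - s ≠ 0 := fun h => by
      have : ‖z‖ = s := by rw [sub_eq_zero.1 h, hsn]
      rw [hz] at this
      exact hs1.ne this.symm
    have hev : a *ᵥ w' = (s * (z - s)⁻¹) • w' := by
      rw [mul_comm, mul_smul, eq_inv_smul_iff₀ hne, sub_smul, sub_eq_iff_eq_add]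
      rw [Matrix.sub_mulVec, Matrix.smul_mulVec, Matrix.add_mulVec, Matrix.one_mulVec,
        Matrix.smul_mulVec, sub_eq_zero, smul_add] at hw'
      exact hw'.symm
    have := specProj_mulVec_of_lt ha hev (by
      have : 1 + s * (z - s)⁻¹ = z * (z - s)⁻¹ := by field_simp; ring
      rw [this, norm_mul, norm_mul, hsn, hz]
      exact mul_lt_mul_of_pos_right hs1 (norm_pos_iff.2 (inv_ne_zero hne)))
    exact this.symm.trans hPw'
  rw [hw0, hw0', add_zero] at hsum
  exact hv0 hsum

end Spectral

section Transport

variable {X Z : Type} [TopologicalSpace X] [TopologicalSpace Z]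
variable {ι κ : Type} [Fintype ι] [DecidableEq ι] [Fintype κ] [DecidableEq κ]

/-- The intertwiner of two idempotents. -/
def intertwiner (a b : Matrix ι ι ℂ) : Matrix ι ι ℂ := a * b + (1 - a) * (1 - b)

theorem intertwiner_self {a : Matrix ι ι ℂ} (ha : a * a = a) : intertwiner a a = 1 := by
  simp [intertwiner, mul_sub, sub_mul, ha]

theorem mul_intertwiner {a b : Matrix ι ι ℂ} (ha : a * a = a) (hb : b * b = b) :
    a * intertwiner a b = intertwiner a b * b := by
  have h1 : a * (1 - a) = 0 := by rw [mul_sub, ha, mul_one, sub_self]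
  have h2 : (1 - b) * b = 0 := by rw [sub_mul, hb, one_mul, sub_self]
  rw [intertwiner, mul_add, add_mul, ← mul_assoc, ← mul_assoc, ha, h1, mul_assoc a b b, hb,
    mul_assoc _ (1 - b) b, h2, zero_mul, mul_zero]

theorem continuous_intertwiner {a b : Z → Matrix ι ι ℂ} (ha : Continuous a) (hb : Continuous b) :
    Continuous fun z => intertwiner (a z) (b z) :=
  (ha.mul hb).add ((continuous_const.sub ha).mul (continuous_const.sub hb))

theorem exists_uniform_intertwiner [CompactSpace X] {e : I × X → Matrix ι ι ℂ}
    (he : Continuous e) (hi : ∀ z, e z * e z = e z) :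
    ∃ δ > 0, ∀ s t : I, dist s t < δ → ∀ x, IsUnit (intertwiner (e (s, x)) (e (t, x))) := by
  let F : X × (I × I) → ℂ := fun p => (intertwiner (e (p.2.1, p.1)) (e (p.2.2, p.1))).det
  have hF : Continuous F := (continuous_intertwiner (he.comp (by fun_prop))
    (he.comp (by fun_prop))).matrix_det
  have hcl : IsClosed (Prod.snd '' {p : X × (I × I) | F p = 0}) :=
    isClosedMap_snd_of_compactSpace _ (isClosed_singleton.preimage hF)
  have hV : (Prod.snd '' {p : X × (I × I) | F p = 0})ᶜ ∈ uniformity I := by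
    rw [← nhdsSet_diagonal_eq_uniformity]
    refine (hcl.isOpen_compl.mem_nhdsSet).2 ?_
    rintro ⟨s, t⟩ hst ⟨⟨x, s', t'⟩, h0, h⟩
    obtain rfl : s = t := hst
    obtain ⟨rfl, rfl⟩ : s' = s ∧ t' = s := by simpa using h
    simp only [F, Set.mem_ofPred_eq, intertwiner_self (hi _), Matrix.det_one] at h0
    exact one_ne_zero h0
  obtain ⟨δ, hδ, h⟩ := Metric.mem_uniformity_dist.1 hV
  refine ⟨δ, hδ, fun s t hst x => ?_⟩
  rw [Matrix.isUnit_iff_isUnit_det, isUnit_iff_ne_zero]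
  exact fun h0 => h hst ⟨(x, s, t), h0, rfl⟩

theorem exists_transport [CompactSpace X] {e : I × X → Matrix ι ι ℂ}
    (he : Continuous e) (hi : ∀ z, e z * e z = e z) :
    ∃ g : I × X → Matrix ι ι ℂ, Continuous g ∧ (∀ z, IsUnit (g z)) ∧ (∀ x, g (0, x) = 1) ∧
      (∀ t x, e (t, x) * g (t, x) = g (t, x) * e (0, x)) ∧
      ∀ x, (∀ t, e (t, x) = e (0, x)) → ∀ t, g (t, x) = 1 := by
  obtain ⟨δ, hδ, hu⟩ := exists_uniform_intertwiner he hi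
  obtain ⟨N, hN⟩ := exists_nat_one_div_lt hδ
  let clp : ℕ → I → I := fun k t => Set.projIcc 0 1 zero_le_one (min (t : ℝ) (k * (1 / (N + 1))))
  have hclpc : ∀ k, Continuous (clp k) := fun k =>
    continuous_projIcc.comp (by fun_prop : Continuous fun t : I => min (t : ℝ) (k * (1 / (N + 1))))
  have hpos : (0 : ℝ) < 1 / ((N : ℝ) + 1) := by positivity
  have hclp0 : ∀ k, clp k 0 = 0 := fun k => by
    simp only [clp, Set.Icc.coe_zero]
    rw [min_eq_left (by positivity)]
    exact Set.projIcc_left _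
  have hclpz : ∀ t, clp 0 t = 0 := fun t => by
    simp only [clp, Nat.cast_zero, zero_mul]
    rw [min_eq_right t.2.1]
    exact Set.projIcc_left _
  have hclpN : ∀ t, clp (N + 1) t = t := fun t => by
    have : ((N + 1 : ℕ) : ℝ) * (1 / (N + 1)) = 1 := by push_cast; field_simp
    simp only [clp, this]
    rw [min_eq_left t.2.2]
    exact Set.projIcc_val _ t
  have hclpd : ∀ k t, dist (clp (k + 1) t) (clp k t) < δ := fun k t => by
    refine lt_of_le_of_lt ?_ hN
    rw [Subtype.dist_eq, Real.dist_eq]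
    refine (Set.abs_projIcc_sub_projIcc _).trans ((abs_min_sub_min_le_max _ _ _ _).trans ?_)
    rw [sub_self, abs_zero, ← sub_mul]
    push_cast
    rw [add_sub_cancel_left, one_mul, abs_of_pos hpos]
    exact max_le hpos.le le_rfl
  suffices h : ∀ k : ℕ, ∃ g : I × X → Matrix ι ι ℂ, Continuous g ∧ (∀ z, IsUnit (g z)) ∧
      (∀ x, g (0, x) = 1) ∧ (∀ t x, e (clp k t, x) * g (t, x) = g (t, x) * e (0, x)) ∧
      ∀ x, (∀ t, e (t, x) = e (0, x)) → ∀ t, g (t, x) = 1 by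
    simpa only [hclpN] using h (N + 1)
  intro k
  induction k with
  | zero =>
    exact ⟨fun _ => 1, continuous_const, fun _ => isUnit_one, fun _ => rfl,
      fun t x => by rw [hclpz, mul_one, one_mul], fun _ _ _ => rfl⟩
  | succ k ih =>
    obtain ⟨g, hg, hgu, hg0, hge, hgc⟩ := ih
    refine ⟨fun z => intertwiner (e (clp (k + 1) z.1, z.2)) (e (clp k z.1, z.2)) * g z,
      (continuous_intertwiner (he.comp ?_) (he.comp ?_)).mul hg, fun z => ?_, fun x => ?_,
      fun t x => ?_, fun x hx t => ?_⟩
    · exact ((hclpc _).comp continuous_fst).prodMk continuous_snd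
    · exact ((hclpc _).comp continuous_fst).prodMk continuous_snd
    · exact (hu _ _ (hclpd k z.1) z.2).mul (hgu z)
    · simp only [hclp0, intertwiner_self (hi _), hg0, one_mul]
    · rw [← mul_assoc, mul_intertwiner (hi _) (hi _), mul_assoc, hge, mul_assoc]
    · simp only [hx (clp (k + 1) t), hx (clp k t), intertwiner_self (hi _), hgc x hx t, one_mul]

/-- Every pointwise invertible matrix function on `(X, Y)` is stably contractible. -/
def KOne (X : Type) [TopologicalSpace X] (Y : Set X) : Prop :=
  ∀ (ι : Type) [Fintype ι] [DecidableEq ι] (u : X → Matrix ι ι ℂ), Continuous u →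
    (∀ x, IsUnit (u x)) → (∀ y ∈ Y, u y = 1) →
    ∃ (κ : Type) (_ : Fintype κ) (_ : DecidableEq κ) (h : I × X → Matrix (ι ⊕ κ) (ι ⊕ κ) ℂ),
      Continuous h ∧ (∀ z, IsUnit (h z)) ∧ (∀ t, ∀ y ∈ Y, h (t, y) = 1) ∧
      (∀ x, h (0, x) = 1) ∧ ∀ x, h (1, x) = stab κ (u x)

/-- Every idempotent matrix function on `(X, Y)` is stably conjugate to a constant one. -/
def KZero (X : Type) [TopologicalSpace X] (Y : Set X) : Prop :=
  ∀ (ι : Type) [Fintype ι] [DecidableEq ι] (e : X → Matrix ι ι ℂ) (p : Matrix ι ι ℂ),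
    Continuous e → (∀ x, e x * e x = e x) → p * p = p → (∀ y ∈ Y, e y = p) →
    ∃ (κ : Type) (_ : Fintype κ) (_ : DecidableEq κ) (q : Matrix κ κ ℂ)
      (g : X → Matrix (ι ⊕ κ) (ι ⊕ κ) ℂ),
      q * q = q ∧ Continuous g ∧ (∀ x, IsUnit (g x)) ∧ (∀ y ∈ Y, g y = 1) ∧
      ∀ x, fromBlocks (e x) 0 0 q * g x = g x * fromBlocks p 0 0 q

/-- The relative boundary of the cylinder over `(X, Y)`. -/
def cylBd (Y : Set X) : Set (I × X) := {z | z.1 = 0 ∨ z.1 = 1 ∨ z.2 ∈ Y}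

theorem isUnit_compress {p w : Matrix ι ι ℂ} (hp : p * p = p) (hw : IsUnit w)
    (hpw : p * w = w * p) : IsUnit (p * w + (1 - p)) := by
  refine IsUnit.of_mul_eq_one (p * w⁻¹ + (1 - p)) ?_
  have h1 : p * w * (1 - p) = 0 := by
    rw [hpw, mul_assoc, mul_sub, hp, mul_one, sub_self, mul_zero]
  have h2 : (1 - p) * (p * w⁻¹) = 0 := by
    rw [← mul_assoc, sub_mul, hp, one_mul, sub_self, zero_mul]
  have h3 : p * w * (p * w⁻¹) = p := by
    rw [hpw, mul_assoc w p, ← mul_assoc p p, hp, ← mul_assoc, ← hpw, mul_assoc,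
      mul_inv_of_isUnit hw, mul_one]
  rw [add_mul, mul_add, mul_add, h1, h2, h3]
  simp [mul_sub, sub_mul, hp]

/-- The involution exchanging `p ⊕ (1 - p)` and `1 ⊕ 0`. -/
def straighten (p : Matrix ι ι ℂ) : Matrix (ι ⊕ ι) (ι ⊕ ι) ℂ :=
  fromBlocks p (1 - p) (1 - p) p

theorem straighten_mul_self {p : Matrix ι ι ℂ} (hp : p * p = p) :
    straighten p * straighten p = 1 := by
  rw [straighten, fromBlocks_multiply, ← fromBlocks_one]
  congr 1 <;> simp [mul_sub, sub_mul, hp]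

theorem straighten_conj {p w : Matrix ι ι ℂ} (hp : p * p = p) (hpw : p * w = w * p) :
    straighten p * fromBlocks w 0 0 1 * straighten p =
      fromBlocks (p * w + (1 - p)) 0 0 ((1 - p) * w + p) := by
  have h2 : w * p * p = w * p := by rw [mul_assoc, hp]
  rw [straighten, fromBlocks_multiply, fromBlocks_multiply]
  congr 1 <;> simp [mul_sub, sub_mul, hp, hpw, h2]

theorem straighten_conj_idem {p : Matrix ι ι ℂ} (hp : p * p = p) :
    straighten p * fromBlocks p 0 0 (1 - p) = fromBlocks 1 0 0 0 * straighten p := by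
  rw [straighten, fromBlocks_multiply, fromBlocks_multiply]
  congr 1 <;> simp [mul_sub, sub_mul, hp]


theorem isUnit_straighten {p : Matrix ι ι ℂ} (hp : p * p = p) : IsUnit (straighten p) :=
  IsUnit.of_mul_eq_one _ (straighten_mul_self hp)

/-- A contraction of an invertible function commuting with `p` may be chosen to commute with
a stabilization of `p`. -/
theorem KOne.exists_commuting {Y : Set X} (H : KOne X Y) {p : Matrix ι ι ℂ} (hp : p * p = p)
    {w : X → Matrix ι ι ℂ} (hw : Continuous w) (hu : ∀ x, IsUnit (w x)) (hY : ∀ y ∈ Y, w y = 1)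
    (hpw : ∀ x, p * w x = w x * p) :
    ∃ (κ : Type) (_ : Fintype κ) (_ : DecidableEq κ) (q : Matrix κ κ ℂ)
      (k : I × X → Matrix (ι ⊕ κ) (ι ⊕ κ) ℂ), q * q = q ∧ Continuous k ∧ (∀ z, IsUnit (k z)) ∧
      (∀ t, ∀ y ∈ Y, k (t, y) = 1) ∧ (∀ x, k (0, x) = 1) ∧ (∀ x, k (1, x) = stab κ (w x)) ∧
      ∀ z, fromBlocks p 0 0 q * k z = k z * fromBlocks p 0 0 q := by
  have hp' : (1 - p) * (1 - p) = 1 - p := by simp [mul_sub, sub_mul, hp]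
  have hpw' : ∀ x, (1 - p) * w x = w x * (1 - p) := fun x => by
    rw [sub_mul, mul_sub, hpw, one_mul, mul_one]
  obtain ⟨κ₁, _, _, h₁, h₁c, h₁u, h₁Y, h₁0, h₁1⟩ := H ι (fun x => p * w x + (1 - p))
    ((continuous_const.mul hw).add continuous_const) (fun x => isUnit_compress hp (hu x) (hpw x))
    (fun y hy => by rw [hY y hy, mul_one, add_sub_cancel])
  obtain ⟨κ₂, _, _, h₂, h₂c, h₂u, h₂Y, h₂0, h₂1⟩ := H ι (fun x => (1 - p) * w x + p)
    ((continuous_const.mul hw).add continuous_const)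
    (fun x => by simpa using isUnit_compress hp' (hu x) (hpw' x))
    (fun y hy => by rw [hY y hy, mul_one, sub_add_cancel])
  let e₁ := Equiv.sumSumSumComm ι ι κ₁ κ₂
  let e₂ := (Equiv.sumAssoc ι ι (κ₁ ⊕ κ₂)).symm
  let m : Matrix (κ₁ ⊕ κ₂) (κ₁ ⊕ κ₂) ℂ := fromBlocks 1 0 0 0
  let S : Matrix ((ι ⊕ ι) ⊕ (κ₁ ⊕ κ₂)) ((ι ⊕ ι) ⊕ (κ₁ ⊕ κ₂)) ℂ := stab _ (straighten p)
  have hm : m * m = m := by simp [m, fromBlocks_multiply]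
  have hS : S * S = 1 := by
    simp only [S]
    rw [← stab_mul, straighten_mul_self hp, stab, fromBlocks_one]
  let h : I × X → Matrix ((ι ⊕ ι) ⊕ (κ₁ ⊕ κ₂)) ((ι ⊕ ι) ⊕ (κ₁ ⊕ κ₂)) ℂ :=
    fun z => (fromBlocks (h₁ z) 0 0 (h₂ z)).submatrix e₁ e₁
  have h_c : Continuous h :=
    (h₁c.matrix_fromBlocks continuous_const continuous_const h₂c).matrix_submatrix _ _
  have h_u : ∀ z, IsUnit (h z) := fun z =>
    (Matrix.isUnit_submatrix_equiv e₁ e₁).2 (isUnit_blockDiag (h₁u z) (h₂u z))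
  have h_comm : ∀ z, fromBlocks (fromBlocks 1 0 0 0) 0 0 m * h z
      = h z * fromBlocks (fromBlocks 1 0 0 0) 0 0 m := fun z => by
    have : (fromBlocks (fromBlocks 1 0 0 0) 0 0 m :
        Matrix ((ι ⊕ ι) ⊕ (κ₁ ⊕ κ₂)) ((ι ⊕ ι) ⊕ (κ₁ ⊕ κ₂)) ℂ)
        = (fromBlocks (1 : Matrix (ι ⊕ κ₁) (ι ⊕ κ₁) ℂ) 0 0 0).submatrix e₁ e₁ := by
      ext i j
      rcases i with (i | i) | (i | i) <;> rcases j with (j | j) | (j | j) <;>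
        simp [m, e₁, Matrix.one_apply]
    simp only [h]
    rw [this, Matrix.submatrix_mul_equiv, Matrix.submatrix_mul_equiv, fromBlocks_multiply,
      fromBlocks_multiply]
    simp
  have h_one : (fromBlocks (1 : Matrix (ι ⊕ κ₁) (ι ⊕ κ₁) ℂ) 0 0
      (1 : Matrix (ι ⊕ κ₂) (ι ⊕ κ₂) ℂ)).submatrix e₁ e₁ = 1 := by
    rw [fromBlocks_one, Matrix.submatrix_one_equiv]
  have h_end : ∀ x, h (1, x) = S * stab _ (stab ι (w x)) * S := fun x => by
    simp only [S]
    rw [← stab_mul, ← stab_mul, straighten_conj hp (hpw x)]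
    simp only [h, h₁1, h₂1]
    ext i j
    rcases i with (i | i) | (i | i) <;> rcases j with (j | j) | (j | j) <;>
      simp [e₁, Matrix.one_apply]
  have hSE : S * fromBlocks (fromBlocks p 0 0 (1 - p)) 0 0 m
      = fromBlocks (fromBlocks 1 0 0 0) 0 0 m * S := by
    simp only [S, stab]
    rw [fromBlocks_multiply, fromBlocks_multiply, straighten_conj_idem hp]
    simp
  have hSu : IsUnit S := IsUnit.of_mul_eq_one _ hS
  have hSc : ∀ z, fromBlocks (fromBlocks p 0 0 (1 - p)) 0 0 m * (S * h z * S)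
      = (S * h z * S) * fromBlocks (fromBlocks p 0 0 (1 - p)) 0 0 m := fun z => by
    generalize fromBlocks (fromBlocks p 0 0 (1 - p)) 0 0 m = Q at *
    have hc := h_comm z
    generalize (fromBlocks (fromBlocks 1 0 0 0) 0 0 m :
      Matrix ((ι ⊕ ι) ⊕ (κ₁ ⊕ κ₂)) ((ι ⊕ ι) ⊕ (κ₁ ⊕ κ₂)) ℂ) = E at *
    have hSE' : Q * S = S * E := by
      calc Q * S = S * (S * Q) * S := by rw [← mul_assoc, hS, one_mul]
        _ = S * E := by rw [hSE, mul_assoc, mul_assoc, hS, mul_one]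
    calc Q * (S * h z * S) = S * (E * h z) * S := by
          rw [← mul_assoc, ← mul_assoc, hSE', mul_assoc S]
      _ = S * h z * (E * S) := by rw [hc]; simp only [mul_assoc]
      _ = S * h z * S * Q := by rw [← hSE]; simp only [mul_assoc]
  refine ⟨ι ⊕ (κ₁ ⊕ κ₂), inferInstance, inferInstance, fromBlocks (1 - p) 0 0 m,
    fun z => (S * h z * S).submatrix e₂ e₂, ?_, ?_, ?_, ?_, ?_, ?_, ?_⟩
  · rw [fromBlocks_multiply]; simp [hp', hm]
  · exact ((continuous_const.mul h_c).mul continuous_const).matrix_submatrix _ _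
  · exact fun z => (Matrix.isUnit_submatrix_equiv e₂ e₂).2 ((hSu.mul (h_u z)).mul hSu)
  · intro t y hy
    simp only [h]
    rw [h₁Y t y hy, h₂Y t y hy, h_one, mul_one, hS, Matrix.submatrix_one_equiv]
  · intro x
    simp only [h]
    rw [h₁0, h₂0, h_one, mul_one, hS, Matrix.submatrix_one_equiv]
  · intro x
    have : S * (S * stab (κ₁ ⊕ κ₂) (stab ι (w x)) * S) * S = stab (κ₁ ⊕ κ₂) (stab ι (w x)) := by
      rw [← mul_assoc, ← mul_assoc, hS, one_mul, mul_assoc, hS, mul_one]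
    simp only [h_end]
    rw [this, stab_stab_submatrix]
  · intro z
    have : (fromBlocks p 0 0 (fromBlocks (1 - p) 0 0 m) : Matrix (ι ⊕ (ι ⊕ (κ₁ ⊕ κ₂))) _ ℂ)
        = (fromBlocks (fromBlocks p 0 0 (1 - p)) 0 0 m).submatrix e₂ e₂ := by
      ext i j
      rcases i with i | i | i <;> rcases j with j | j | j <;> simp [e₂]
    rw [this, Matrix.submatrix_mul_equiv, Matrix.submatrix_mul_equiv, hSc]

theorem KOne.kZero [CompactSpace X] {Y : Set X} (H : KOne X Y) : KZero (I × X) (cylBd Y) := by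
  intro ι _ _ e p he hi hp hbd
  obtain ⟨g, hg, hgu, hg0, hge, hgc⟩ := exists_transport he hi
  have he0 : ∀ x, e (0, x) = p := fun x => hbd _ (Or.inl rfl)
  have he1 : ∀ x, e (1, x) = p := fun x => hbd _ (Or.inr (Or.inl rfl))
  have hgY : ∀ t, ∀ y ∈ Y, g (t, y) = 1 := fun t y hy =>
    hgc y (fun t => by rw [hbd _ (Or.inr (Or.inr hy)), he0]) t
  obtain ⟨κ, _, _, q, k, hq, hk, hku, hkY, hk0, hk1, hkc⟩ := H.exists_commuting hp
    (w := fun x => g (1, x)) (hg.comp (by fun_prop)) (fun x => hgu _) (fun y hy => hgY 1 y hy)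
    (fun x => by simpa only [he0, he1] using hge 1 x)
  refine ⟨κ, _, _, q, fun z => stab κ (g z) * (k z)⁻¹, hq,
    (hg.matrix_fromBlocks continuous_const continuous_const continuous_const).mul
      (continuous_matrix_inv hk hku),
    fun z => (isUnit_blockDiag (hgu z) isUnit_one).mul (isUnit_inv_of_isUnit (hku z)), ?_, ?_⟩
  · rintro ⟨t, x⟩ h
    have h1 : stab κ (1 : Matrix ι ι ℂ) = 1 := fromBlocks_one
    rcases h with h | h | h
    · obtain rfl : t = 0 := h
      simp only [hg0, hk0, h1, inv_one, mul_one]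
    · obtain rfl : t = 1 := h
      simp only [hk1]
      exact mul_inv_of_isUnit (isUnit_blockDiag (hgu _) isUnit_one)
    · simp only [hgY t x h, hkY t x h, h1, inv_one, mul_one]
  · rintro ⟨t, x⟩
    have hc : Commute (fromBlocks p 0 0 q) (k (t, x))⁻¹ := commute_inv (hku _) (hkc _)
    have h1 : fromBlocks (e (t, x)) 0 0 q * stab κ (g (t, x))
        = stab κ (g (t, x)) * fromBlocks p 0 0 q := by
      rw [fromBlocks_multiply, fromBlocks_multiply, hge, he0]
      simp
    rw [← mul_assoc, h1, mul_assoc, mul_assoc, hc.eq]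

end Transport

section Bott

variable {X Z : Type} [TopologicalSpace X] [TopologicalSpace Z]
variable {ι κ : Type} [Fintype ι] [DecidableEq ι] [Fintype κ] [DecidableEq κ] {Y : Set X}

theorem exists_circ_eq {z : ℂ} (hz : ‖z‖ = 1) : ∃ t : I, circ t = z := by
  obtain ⟨θ, hθ⟩ : ∃ θ : ℝ, Complex.exp (θ * Complex.I) = z :=
    ⟨z.arg, by simpa [hz] using Complex.norm_mul_exp_arg_mul_I z⟩
  refine ⟨⟨Int.fract (θ / (2 * Real.pi)), Int.fract_nonneg _, (Int.fract_lt_one _).le⟩, ?_⟩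
  rw [← hθ, circ, Complex.exp_eq_exp_iff_exists_int]
  refine ⟨-⌊θ / (2 * Real.pi)⌋, ?_⟩
  have : (Int.fract (θ / (2 * Real.pi)) : ℝ) = θ / (2 * Real.pi) - ⌊θ / (2 * Real.pi)⌋ := rfl
  simp only [this]
  have hpi : (Real.pi : ℂ) ≠ 0 := by exact_mod_cast Real.pi_ne_zero
  push_cast
  field_simp
  ring

/-- The clutching function of an idempotent. -/
def clutch (p : Matrix ι ι ℂ) (z : ℂ) : Matrix ι ι ℂ := p + z • (1 - p)

theorem clutch_mul {p : Matrix ι ι ℂ} (hp : p * p = p) (z w : ℂ) :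
    clutch p z * clutch p w = clutch p (z * w) := by
  have h1 : p * (1 - p) = 0 := by rw [mul_sub, hp, mul_one, sub_self]
  have h2 : (1 - p) * p = 0 := by rw [sub_mul, hp, one_mul, sub_self]
  have h3 : (1 - p) * (1 - p) = 1 - p := by rw [mul_sub, h2, mul_one, sub_zero]
  simp only [clutch, add_mul, mul_add, smul_mul_assoc, mul_smul_comm, h1, h2, h3, hp]
  simp [smul_smul, mul_comm w z]

theorem clutch_one (p : Matrix ι ι ℂ) : clutch p 1 = 1 := by simp [clutch]

theorem isUnit_clutch {p : Matrix ι ι ℂ} (hp : p * p = p) {z : ℂ} (hz : z ≠ 0) :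
    IsUnit (clutch p z) :=
  IsUnit.of_mul_eq_one (clutch p z⁻¹) (by rw [clutch_mul hp, mul_inv_cancel₀ hz, clutch_one])

theorem clutch_blockDiag (p : Matrix ι ι ℂ) (q : Matrix κ κ ℂ) (z : ℂ) :
    clutch (fromBlocks p 0 0 q) z = fromBlocks (clutch p z) 0 0 (clutch q z) := by
  rw [clutch, ← fromBlocks_one, sub_eq_add_neg, fromBlocks_neg, fromBlocks_add, fromBlocks_smul,
    fromBlocks_add]
  simp [clutch, sub_eq_add_neg]

theorem continuous_clutch {p : Z → Matrix ι ι ℂ} {f : Z → ℂ} (hp : Continuous p)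
    (hf : Continuous f) : Continuous fun z => clutch (p z) (f z) :=
  hp.add (hf.smul (continuous_const.sub hp))

theorem continuous_circ_coe : Continuous fun t : I => circ t :=
  continuous_circ.comp continuous_subtype_val

theorem good_clutch (hYne : Y.Nonempty) (H : KZero X Y) {P : X → Matrix ι ι ℂ}
    (hP : Continuous P) (hi : ∀ x, P x * P x = P x) (hY : ∀ y ∈ Y, ∀ y' ∈ Y, P y = P y') :
    Good Y (fun z => clutch (P z.2) (circ z.1)) := by
  obtain ⟨y₀, hy₀⟩ := hYne
  obtain ⟨κ, _, _, q, g, hq, hg, hgu, hgY, hgP⟩ := H ι P (P y₀) hP hi (hi y₀)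
    (fun y hy => hY y hy y₀ hy₀)
  refine Good.of_stab (κ := κ) ?_
  have hE : fromBlocks (P y₀) 0 0 q * fromBlocks (P y₀) 0 0 q = fromBlocks (P y₀) 0 0 q := by
    rw [fromBlocks_multiply]; simp [hi, hq]
  have h1 := Good.mul_space_left (Y := Y)
    (α := fun t => clutch (fromBlocks (P y₀) 0 0 q) (circ t))
    (continuous_clutch continuous_const continuous_circ_coe)
    (fun t => isUnit_clutch hE (circ_ne_zero _)) (by simp [circ_zero, circ_one]) hg hgu
    (fun y hy y' hy' => by rw [hgY y hy, hgY y' hy'])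
  have h2 := h1.mul_right (β := fun x => (g x)⁻¹) (continuous_matrix_inv hg hgu)
    (fun x => isUnit_inv_of_isUnit (hgu x)) (fun y hy y' hy' => by rw [hgY y hy, hgY y' hy'])
  have h3 := h2.mul_left (α := fun t => fromBlocks 1 0 0 (clutch q (circ t)⁻¹))
    (continuous_const.matrix_fromBlocks continuous_const continuous_const
      (continuous_clutch continuous_const (continuous_circ_coe.inv₀ fun _ => circ_ne_zero _)))
    (fun t => isUnit_blockDiag isUnit_one (isUnit_clutch hq (inv_ne_zero (circ_ne_zero _))))
    (by simp [circ_zero, circ_one])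
  convert h3 using 2 with z
  have hconj : clutch (fromBlocks (P z.2) 0 0 q) (circ z.1)
      = g z.2 * clutch (fromBlocks (P y₀) 0 0 q) (circ z.1) * (g z.2)⁻¹ := by
    have : clutch (fromBlocks (P z.2) 0 0 q) (circ z.1) * g z.2
        = g z.2 * clutch (fromBlocks (P y₀) 0 0 q) (circ z.1) := by
      simp only [clutch, add_mul, mul_add, sub_mul, mul_sub, smul_mul_assoc, mul_smul_comm, hgP,
        one_mul, mul_one]
    rw [← this, mul_assoc, mul_inv_of_isUnit (hgu _), mul_one]
  rw [← hconj, clutch_blockDiag, fromBlocks_multiply]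
  simp [clutch_mul hq, circ_ne_zero, clutch_one]

theorem good_pencil_normalized (hYne : Y.Nonempty) (H : KZero X Y) {a : X → Matrix ι ι ℂ}
    (hc : Continuous a) (ha : ∀ x, ∀ z : ℂ, ‖z‖ = 1 → IsUnit (1 + a x - z • a x))
    (hY : ∀ y ∈ Y, ∀ y' ∈ Y, a y = a y') :
    Good Y (fun z => 1 + a z.2 - circ z.1 • a z.2) := by
  let D : ℝ → ℂ → X → Matrix ι ι ℂ := fun s w x =>
    (1 + a x - ((s : ℂ) * w) • a x) * specProj (a x)
      + ((s : ℂ) • (1 + a x) - w • a x) * (1 - specProj (a x))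
  have hP := continuous_specProj hc ha
  have hPY : ∀ y ∈ Y, ∀ y' ∈ Y, specProj (a y) = specProj (a y') := fun y hy y' hy' => by
    rw [hY y hy y' hy']
  let C : X → Matrix ι ι ℂ := fun x => (1 + a x) * specProj (a x) - a x * (1 - specProj (a x))
  have hD0 : ∀ w x, D 0 w x = clutch (specProj (a x)) w * C x := fun w x => by
    have h1 := specProj_mul_self (ha x)
    have h2 := commute_specProj (ha x)
    simp only [D, C, clutch]
    generalize specProj (a x) = P at *
    simp only [Complex.ofReal_zero, zero_mul, zero_smul, sub_zero, add_mul, sub_mul,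
      mul_add, mul_sub, smul_mul_assoc, mul_one, one_mul, h1, h2, smul_sub, smul_add]
    rw [← mul_assoc, h1]
    abel
  have hCu : ∀ x, IsUnit (C x) := fun x => by
    have := isUnit_pencil_deform (ha x) (s := 0) ⟨le_rfl, zero_le_one⟩ (z := 1) norm_one
    have h := hD0 1 x
    simp only [D] at h
    rw [h, clutch_one, one_mul] at this
    exact this
  have hCc : Continuous C :=
    ((continuous_const.add hc).mul hP).sub (hc.mul (continuous_const.sub hP))
  have hgood : Good Y (fun z => D 0 (circ z.1) z.2) := by
    simp only [hD0]
    exact (good_clutch hYne H hP (fun x => specProj_mul_self (ha x)) hPY).mul_right hCc hCu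
      (fun y hy y' hy' => by simp only [C]; rw [hY y hy y' hy'])
  refine Good.of_htpc ?_ hgood
  have hcirc : Continuous fun p : I × (I × X) => circ p.2.1 := continuous_circ.comp (by fun_prop)
  have ha' : Continuous fun p : I × (I × X) => a p.2.2 := hc.comp (by fun_prop)
  have hP' : Continuous fun p : I × (I × X) => specProj (a p.2.2) :=
    hP.comp (by fun_prop : Continuous fun p : I × (I × X) => p.2.2)
  have hs : Continuous fun p : I × (I × X) => (((unitInterval.symm p.1 : I) : ℝ) : ℂ) := by
    fun_prop
  have hcont : Continuous fun p : I × (I × X) => D (unitInterval.symm p.1) (circ p.2.1) p.2.2 := by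
    refine Continuous.add (Continuous.mul ?_ hP') (Continuous.mul ?_ (continuous_const.sub hP'))
    · exact (continuous_const.add ha').sub ((hs.mul hcirc).smul ha')
    · exact (hs.smul (continuous_const.add ha')).sub (hcirc.smul ha')
  refine ⟨_, hcont, fun s => ⟨hcont.comp (by fun_prop : Continuous fun z : I × X => (s, z)),
    fun z => isUnit_pencil_deform (ha _) (unitInterval.symm s).2 (norm_circ _),
    fun t y hy y' hy' => ?_, fun x => ?_⟩, fun z => ?_, fun z => ?_⟩
  · simp only [D]; rw [hY y hy y' hy']
  · simp [circ_zero, circ_one]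
  · simp [D, mul_sub]
  · simp

theorem good_pencil (hYne : Y.Nonempty) (H : KZero X Y) {a₀ a₁ : X → Matrix ι ι ℂ}
    (h₀ : Continuous a₀) (h₁ : Continuous a₁)
    (hu : ∀ z : I × X, IsUnit (a₀ z.2 + circ z.1 • a₁ z.2))
    (hY₀ : ∀ y ∈ Y, ∀ y' ∈ Y, a₀ y = a₀ y') (hY₁ : ∀ y ∈ Y, ∀ y' ∈ Y, a₁ y = a₁ y') :
    Good Y (fun z => a₀ z.2 + circ z.1 • a₁ z.2) := by
  have hB : ∀ x, IsUnit (a₀ x + a₁ x) := fun x => by simpa [circ_zero] using hu (0, x)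
  have hBc : Continuous fun x => a₀ x + a₁ x := h₀.add h₁
  have hBi := continuous_matrix_inv hBc hB
  have key : ∀ (z : ℂ) x, 1 + -(a₁ x * (a₀ x + a₁ x)⁻¹) - z • -(a₁ x * (a₀ x + a₁ x)⁻¹)
      = (a₀ x + z • a₁ x) * (a₀ x + a₁ x)⁻¹ := fun z x => by
    have h := mul_inv_of_isUnit (hB x)
    generalize (a₀ x + a₁ x)⁻¹ = R at *
    rw [← h, add_mul, add_mul, smul_mul_assoc, smul_neg]
    abel
  have h := good_pencil_normalized hYne H (a := fun x => -(a₁ x * (a₀ x + a₁ x)⁻¹))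
    (h₁.mul hBi).neg (fun x z hz => by
      obtain ⟨t, rfl⟩ := exists_circ_eq hz
      rw [key]
      exact (hu (t, x)).mul (isUnit_inv_of_isUnit (hB x)))
    (fun y hy y' hy' => by rw [hY₀ y hy y' hy', hY₁ y hy y' hy'])
  have h' := h.mul_right (β := fun x => a₀ x + a₁ x) hBc hB
    (fun y hy y₂ hy₂ => by rw [hY₀ y hy y₂ hy₂, hY₁ y hy y₂ hy₂])
  convert h' using 2 with z
  rw [key, mul_assoc, inv_mul_of_isUnit (hB _), mul_one]

/-- Higman's linearization trick. -/
theorem Good.of_linearization {a₀ : X → Matrix ι ι ℂ} {r : I × X → Matrix ι ι ℂ} (hr : Continuous r)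
    (hrY : ∀ t, ∀ y ∈ Y, ∀ y' ∈ Y, r (t, y) = r (t, y')) (hrl : ∀ x, r (0, x) = r (1, x))
    (hF : Adm Y (fun z => a₀ z.2 + circ z.1 • r z))
    (h : Good Y (fun z => fromBlocks (a₀ z.2) (circ z.1 • 1) (-r z) 1)) :
    Good Y (fun z => a₀ z.2 + circ z.1 • r z) := by
  refine Good.of_stab (κ := ι) (Good.of_htpc ?_ h)
  have hL : ∀ s : I, Adm Y (fun z : I × X =>
      (fromBlocks 1 (((s : ℂ) * circ z.1) • 1) 0 1 : Matrix (ι ⊕ ι) (ι ⊕ ι) ℂ)) := fun s => {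
    cont := by
      have : Continuous fun z : I × X => circ z.1 := continuous_circ_coe.comp continuous_fst
      exact continuous_const.matrix_fromBlocks
        ((continuous_const.mul this).smul continuous_const) continuous_const continuous_const
    unit := fun z => Matrix.isUnit_fromBlocks_zero₂₁.2 ⟨isUnit_one, isUnit_one⟩
    const := fun _ _ _ _ _ => rfl
    loop := fun x => by simp [circ_zero, circ_one] }
  have hR : ∀ s : I, Adm Y (fun z : I × X =>
      (fromBlocks 1 0 (-((s : ℂ) • r z)) 1 : Matrix (ι ⊕ ι) (ι ⊕ ι) ℂ)) := fun s => {
    cont := by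
      have : Continuous fun z => -((s : ℂ) • r z) := by fun_prop
      exact continuous_const.matrix_fromBlocks continuous_const this continuous_const
    unit := fun z => Matrix.isUnit_fromBlocks_zero₁₂.2 ⟨isUnit_one, isUnit_one⟩
    const := fun t y hy y' hy' => by rw [hrY t y hy y' hy']
    loop := fun x => by rw [hrl] }
  refine ⟨fun p => fromBlocks 1 (((p.1 : ℂ) * circ p.2.1) • 1) 0 1 *
    stab ι (a₀ p.2.2 + circ p.2.1 • r p.2) * fromBlocks 1 0 (-((p.1 : ℂ) • r p.2)) 1, ?_,
    fun s => ((hL s).mul hF.stab).mul (hR s), fun z => ?_, fun z => ?_⟩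
  · have hcirc : Continuous fun p : I × (I × X) => circ p.2.1 :=
      continuous_circ.comp (by fun_prop)
    have hr' : Continuous fun p : I × (I × X) => r p.2 := hr.comp continuous_snd
    have hs : Continuous fun p : I × (I × X) => ((p.1 : ℝ) : ℂ) := by fun_prop
    have hF' : Continuous fun p : I × (I × X) => a₀ p.2.2 + circ p.2.1 • r p.2 :=
      hF.cont.comp continuous_snd
    refine Continuous.mul (Continuous.mul ?_ ?_) ?_
    · exact continuous_const.matrix_fromBlocks
        ((hs.mul hcirc).smul continuous_const) continuous_const continuous_const
    · exact hF'.matrix_fromBlocks continuous_const continuous_const continuous_const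
    · exact continuous_const.matrix_fromBlocks continuous_const (hs.smul hr').neg
        continuous_const
  · simp
  · simp [fromBlocks_multiply]

theorem good_polynomial (hYne : Y.Nonempty) (H : KZero X Y) (N : ℕ) :
    ∀ (ι : Type) [Fintype ι] [DecidableEq ι] (a : ℕ → X → Matrix ι ι ℂ),
      (∀ j, Continuous (a j)) → (∀ j, ∀ y ∈ Y, ∀ y' ∈ Y, a j y = a j y') →
      (∀ z : I × X, IsUnit (∑ j ∈ Finset.range (N + 2), circ z.1 ^ j • a j z.2)) →
      Good Y (fun z => ∑ j ∈ Finset.range (N + 2), circ z.1 ^ j • a j z.2) := by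
  induction N with
  | zero =>
    intro ι _ _ a ha hY hu
    simp only [zero_add, Finset.sum_range_succ, Finset.sum_range_zero, pow_zero, one_smul,
      pow_one] at hu ⊢
    exact good_pencil hYne H (ha 0) (ha 1) hu (hY 0) (hY 1)
  | succ N ih =>
    intro ι _ _ a ha hY hu
    have hcirc : Continuous fun z : I × X => circ z.1 := continuous_circ_coe.comp continuous_fst
    have key : ∀ z : I × X, ∑ j ∈ Finset.range (N + 1 + 2), circ z.1 ^ j • a j z.2
        = a 0 z.2 + circ z.1 • ∑ j ∈ Finset.range (N + 2), circ z.1 ^ j • a (j + 1) z.2 :=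
      fun z => by
        rw [Finset.sum_range_succ', add_comm, Finset.smul_sum]
        simp [smul_smul, pow_succ']
    simp only [key] at hu ⊢
    have hr : Continuous fun z : I × X =>
        ∑ j ∈ Finset.range (N + 2), circ z.1 ^ j • a (j + 1) z.2 :=
      continuous_finsetSum _ fun j _ => (hcirc.pow j).smul ((ha _).comp continuous_snd)
    have hrY : ∀ t : I, ∀ y ∈ Y, ∀ y' ∈ Y,
        ∑ j ∈ Finset.range (N + 2), circ t ^ j • a (j + 1) y
          = ∑ j ∈ Finset.range (N + 2), circ t ^ j • a (j + 1) y' := fun t y hy y' hy' => by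
      simp only [hY _ y hy y' hy']
    have hF : Adm Y (fun z : I × X =>
        a 0 z.2 + circ z.1 • ∑ j ∈ Finset.range (N + 2), circ z.1 ^ j • a (j + 1) z.2) :=
      { cont := ((ha 0).comp continuous_snd).add (hcirc.smul hr)
        unit := hu
        const := fun t y hy y' hy' => by simp only [hY _ y hy y' hy']
        loop := fun x => by simp [circ_zero, circ_one] }
    refine Good.of_linearization hr hrY (fun x => by simp [circ_zero, circ_one]) hF ?_
    let b : ℕ → X → Matrix (ι ⊕ ι) (ι ⊕ ι) ℂ := fun j x =>
      fromBlocks (if j = 0 then a 0 x else 0) (if j = 1 then 1 else 0) (-a (j + 1) x)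
        (if j = 0 then 1 else 0)
    have hb : ∀ z : I × X, ∑ j ∈ Finset.range (N + 2), circ z.1 ^ j • b j z.2
        = fromBlocks (a 0 z.2) (circ z.1 • 1)
          (-∑ j ∈ Finset.range (N + 2), circ z.1 ^ j • a (j + 1) z.2) 1 := fun z => by
      have : ∀ (s : Finset ℕ) (A B C D : ℕ → Matrix ι ι ℂ),
          ∑ j ∈ s, fromBlocks (A j) (B j) (C j) (D j)
            = fromBlocks (∑ j ∈ s, A j) (∑ j ∈ s, B j) (∑ j ∈ s, C j) (∑ j ∈ s, D j) := by
        intro s A B C D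
        ext i j
        rcases i with i | i <;> rcases j with j | j <;> simp [Matrix.sum_apply]
      simp only [b, fromBlocks_smul, this, smul_ite, smul_zero, Finset.sum_ite_eq',
        Finset.mem_range, smul_neg, Finset.sum_neg_distrib]
      simp
    have hu' : ∀ z : I × X, IsUnit (∑ j ∈ Finset.range (N + 2), circ z.1 ^ j • b j z.2) :=
      fun z => by
        rw [hb]
        set R := ∑ j ∈ Finset.range (N + 2), circ z.1 ^ j • a (j + 1) z.2
        have : (fromBlocks (a 0 z.2) (circ z.1 • 1) (-R) 1 : Matrix (ι ⊕ ι) (ι ⊕ ι) ℂ)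
            = fromBlocks 1 (circ z.1 • 1) 0 1 *
              stab ι (a 0 z.2 + circ z.1 • R) * fromBlocks 1 0 (-R) 1 := by
          simp [fromBlocks_multiply]
        rw [this]
        exact ((Matrix.isUnit_fromBlocks_zero₂₁.2 ⟨isUnit_one, isUnit_one⟩).mul
          (isUnit_blockDiag (hu z) isUnit_one)).mul
          (Matrix.isUnit_fromBlocks_zero₁₂.2 ⟨isUnit_one, isUnit_one⟩)
    have := ih (ι ⊕ ι) b (fun j => ?_) (fun j y hy y₂ hy₂ => ?_) hu'
    · simpa only [hb] using this
    · refine Continuous.matrix_fromBlocks ?_ continuous_const (ha _).neg continuous_const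
      split_ifs
      exacts [ha 0, continuous_const]
    · simp only [b, hY _ y hy y₂ hy₂]

/-- A good family which is trivial on the boundary is contractible relative to the boundary. -/
theorem Good.exists_contraction (hYne : Y.Nonempty) {u : I × X → Matrix ι ι ℂ}
    (hu : ∀ z ∈ cylBd Y, u z = 1) (h : Good Y u) :
    ∃ (κ : Type) (_ : Fintype κ) (_ : DecidableEq κ)
      (h : I × (I × X) → Matrix (ι ⊕ κ) (ι ⊕ κ) ℂ),
      Continuous h ∧ (∀ z, IsUnit (h z)) ∧ (∀ t, ∀ y ∈ cylBd Y, h (t, y) = 1) ∧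
      (∀ x, h (0, x) = 1) ∧ ∀ x, h (1, x) = stab κ (u x) := by
  obtain ⟨y₀, hy₀⟩ := hYne
  obtain ⟨κ, _, _, α, β, hα, hβ, hαu, hβu, hβY, K, hK, hKa, hK0, hK1⟩ := h
  have hKu : ∀ p, IsUnit (K p) := fun p => (hKa p.1).unit p.2
  have hKi := continuous_matrix_inv hK hKu
  have h1 : ∀ p, K p * (K p)⁻¹ = 1 := fun p => mul_inv_of_isUnit (hKu p)
  have h2 : ∀ p, (K p)⁻¹ * K p = 1 := fun p => inv_mul_of_isUnit (hKu p)
  refine ⟨κ, inferInstance, inferInstance, fun p => (K (unitInterval.symm p.1, (p.2.1, y₀)))⁻¹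
    * K (unitInterval.symm p.1, p.2) * (K (unitInterval.symm p.1, (0, p.2.2)))⁻¹
    * K (unitInterval.symm p.1, (0, y₀)), ?_, ?_, ?_, ?_, ?_⟩
  · refine Continuous.mul (Continuous.mul (Continuous.mul ?_ ?_) ?_) ?_
    · exact hKi.comp (by fun_prop :
        Continuous fun p : I × (I × X) => (unitInterval.symm p.1, (p.2.1, y₀)))
    · exact hK.comp (by fun_prop)
    · exact hKi.comp (by fun_prop :
        Continuous fun p : I × (I × X) => (unitInterval.symm p.1, ((0 : I), p.2.2)))
    · exact hK.comp (by fun_prop)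
  · exact fun p => (((isUnit_inv_of_isUnit (hKu _)).mul (hKu _)).mul
      (isUnit_inv_of_isUnit (hKu _))).mul (hKu _)
  · rintro s ⟨t, x⟩ (h | h | h)
    · obtain rfl : t = 0 := h
      simp only
      rw [mul_assoc (K _)⁻¹, h1, mul_one, h2]
    · obtain rfl : t = 1 := h
      have := (hKa (unitInterval.symm s)).loop
      simp only [this]
      rw [mul_assoc (K _)⁻¹, h1, mul_one, h2]
    · have := fun t => (hKa (unitInterval.symm s)).const t x h y₀ hy₀
      simp only [this, h2, one_mul]
  · rintro ⟨t, x⟩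
    simp only [unitInterval.symm_zero, hK1]
    rw [Matrix.mul_inv_rev, Matrix.mul_inv_rev]
    have e1 := inv_mul_of_isUnit (hαu t)
    have e2 := mul_inv_of_isUnit (hβu x)
    have e3 := inv_mul_of_isUnit (hαu 0)
    have e4 := inv_mul_of_isUnit (hβu y₀)
    calc (β y₀)⁻¹ * (α t)⁻¹ * (α t * β x) * ((β x)⁻¹ * (α 0)⁻¹) * (α 0 * β y₀)
        = (β y₀)⁻¹ * ((α t)⁻¹ * α t) * (β x * (β x)⁻¹) * ((α 0)⁻¹ * α 0) * β y₀ := by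
          simp only [mul_assoc]
      _ = 1 := by rw [e1, e2, e3, mul_one, mul_one, mul_one, e4]
  · rintro ⟨t, x⟩
    have e1 : stab κ (1 : Matrix ι ι ℂ) = 1 := fromBlocks_one
    simp only [unitInterval.symm_one, hK0]
    rw [hu (t, y₀) (Or.inr (Or.inr hy₀)), hu (0, x) (Or.inl rfl), hu (0, y₀) (Or.inl rfl), e1,
      inv_one, one_mul, mul_one, mul_one]

end Bott

section

variable {X Z : Type} [TopologicalSpace X] [TopologicalSpace Z]
variable {ι κ : Type} [Fintype ι] [DecidableEq ι] [Fintype κ] [DecidableEq κ]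

section Approximation

variable {E : Type*} [NormedAddCommGroup E] [NormedSpace ℂ E]

theorem exists_partition_approx {T : Type*} [TopologicalSpace T] [CompactSpace T] [T2Space T]
    (F : C(T, E)) {ε : ℝ} (hε : 0 < ε) :
    ∃ (s : Finset T) (φ : T → C(T, ℝ)), ∀ t, ‖F t - ∑ i ∈ s, (φ i t : ℂ) • F i‖ < ε := by
  obtain ⟨s, hs⟩ := isCompact_univ.elim_finite_subcover
    (fun t : T => F ⁻¹' Metric.ball (F t) ε) (fun t => Metric.isOpen_ball.preimage F.continuous)
    (fun t _ => Set.mem_iUnion.2 ⟨t, Metric.mem_ball_self hε⟩)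
  obtain ⟨f, hf⟩ := PartitionOfUnity.exists_isSubordinate_of_locallyFinite (s := Set.univ)
    isClosed_univ (fun i : s => F ⁻¹' Metric.ball (F i) ε)
    (fun t => Metric.isOpen_ball.preimage F.continuous) (locallyFinite_of_finite _)
    (by simpa [Set.iUnion_subtype] using hs)
  classical
  refine ⟨s, fun t => if h : t ∈ s then f ⟨t, h⟩ else 0, fun t => ?_⟩
  have h1 : ∑ i : s, f i t = 1 := by
    rw [← finsum_eq_sum_of_fintype]; exact f.sum_eq_one (Set.mem_univ t)
  have h2 : ∑ i ∈ s, (((if h : i ∈ s then f ⟨i, h⟩ else 0 : C(T, ℝ)) t : ℝ) : ℂ) • F i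
      = ∑ i : s, f i t • F i := by
    rw [← Finset.sum_coe_sort s]
    refine Finset.sum_congr rfl fun i _ => ?_
    simp
  rw [h2, ← dist_eq_norm, dist_comm, ← Metric.mem_ball]
  have h3 : ∑ i : s, f i t • F i = ∑ᶠ i, f i t • F i := (finsum_eq_sum_of_fintype _).symm
  rw [h3]
  refine (convex_ball (F t) ε).finsum_mem (fun i => f.nonneg i t) (f.sum_eq_one (Set.mem_univ t)) ?_
  intro i hi
  have := hf i (subset_closure (Function.mem_support.2 hi))
  rw [Set.mem_preimage, Metric.mem_ball, dist_comm] at this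
  exact this

theorem exists_fourier_approx (F : C(AddCircle (1 : ℝ), E)) {ε : ℝ} (hε : 0 < ε) :
    ∃ (S : Finset ℤ) (w : ℤ → E), (∀ n, w n ∈ Submodule.span ℂ (Set.range F)) ∧
      ∀ t, ‖F t - ∑ n ∈ S, fourier n t • w n‖ < ε := by
  obtain ⟨s, φ, hφ⟩ := exists_partition_approx F (half_pos hε)
  set δ := ε / 2 / (1 + ∑ i ∈ s, ‖F i‖) with hδ
  have hden : 0 < 1 + ∑ i ∈ s, ‖F i‖ := by positivity
  have hδ0 : 0 < δ := by positivity
  have hap : ∀ i, ∃ c : ℤ →₀ ℂ, ∀ t, ‖(φ i t : ℂ) - ∑ n ∈ c.support, c n * fourier n t‖ < δ := by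
    intro i
    let ψ : C(AddCircle (1 : ℝ), ℂ) := ⟨fun t => (φ i t : ℂ), by fun_prop⟩
    have hmem : ψ ∈ (Submodule.span ℂ (Set.range (@fourier (1 : ℝ)))).topologicalClosure := by
      have : Fact (0 < (1 : ℝ)) := ⟨one_pos⟩
      rw [span_fourier_closure_eq_top]; trivial
    obtain ⟨p, hp, hpd⟩ := Metric.mem_closure_iff.1 hmem δ hδ0
    obtain ⟨c, hc⟩ := (Finsupp.mem_span_range_iff_exists_finsupp).1 hp
    refine ⟨c, fun t => ?_⟩
    have h := (ContinuousMap.dist_lt_iff hδ0).1 hpd t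
    rw [dist_eq_norm] at h
    have : p t = ∑ n ∈ c.support, c n * fourier n t := by
      rw [← hc, Finsupp.sum, ContinuousMap.sum_apply]; rfl
    rw [← this]; exact h
  choose c hc using hap
  classical
  refine ⟨s.biUnion fun i => (c i).support, fun n => ∑ i ∈ s, c i n • F i, ?_, fun t => ?_⟩
  · exact fun n => Submodule.sum_mem _ fun i _ => Submodule.smul_mem _ _
      (Submodule.subset_span ⟨i, rfl⟩)
  · have h1 : ∑ n ∈ s.biUnion (fun i => (c i).support), fourier n t • ∑ i ∈ s, c i n • F i
        = ∑ i ∈ s, (∑ n ∈ (c i).support, c i n * fourier n t) • F i := by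
      simp_rw [Finset.smul_sum]
      rw [Finset.sum_comm]
      refine Finset.sum_congr rfl fun i hi => ?_
      rw [Finset.sum_smul]
      symm
      refine Finset.sum_subset_zero_on_sdiff (Finset.subset_biUnion_of_mem
        (fun i => (c i).support) hi) ?_ ?_
      · intro n hn
        rw [Finset.mem_sdiff, Finsupp.notMem_support_iff] at hn
        simp [hn.2]
      · intro n _
        rw [smul_smul, mul_comm]
    rw [h1]
    have h2 : F t - ∑ i ∈ s, (∑ n ∈ (c i).support, c i n * fourier n t) • F i
        = (F t - ∑ i ∈ s, (φ i t : ℂ) • F i) +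
          ∑ i ∈ s, ((φ i t : ℂ) - ∑ n ∈ (c i).support, c i n * fourier n t) • F i := by
      simp only [sub_smul, Finset.sum_sub_distrib]; abel
    rw [h2]
    have h3 : ‖∑ i ∈ s, ((φ i t : ℂ) - ∑ n ∈ (c i).support, c i n * fourier n t) • F i‖
        ≤ ε / 2 := by
      calc _ ≤ ∑ i ∈ s, δ * ‖F i‖ := by
            refine norm_sum_le_of_le _ fun i _ => ?_
            rw [norm_smul]
            exact mul_le_mul_of_nonneg_right (hc i t).le (norm_nonneg _)
        _ = δ * ∑ i ∈ s, ‖F i‖ := by rw [Finset.mul_sum]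
        _ ≤ δ * (1 + ∑ i ∈ s, ‖F i‖) := by gcongr; linarith
        _ = ε / 2 := by rw [hδ]; field_simp
    calc _ ≤ _ := norm_add_le _ _
      _ < ε / 2 + ε / 2 := by linarith [hφ t]
      _ = ε := by ring

theorem exists_circ_approx (F : C(I, E)) (h01 : F 0 = F 1) {ε : ℝ} (hε : 0 < ε) :
    ∃ (S : Finset ℤ) (w : ℤ → E), (∀ n, w n ∈ Submodule.span ℂ (Set.range F)) ∧
      ∀ t : I, ‖F t - ∑ n ∈ S, circ t ^ n • w n‖ < ε := by
  have : Fact (0 < (1 : ℝ)) := ⟨one_pos⟩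
  let f : ℝ → E := fun t => F (Set.projIcc 0 1 zero_le_one t)
  have hf : Continuous f := F.continuous.comp continuous_projIcc
  have hG : Continuous (AddCircle.liftIco 1 0 f) := by
    refine AddCircle.liftIco_continuous ?_ hf.continuousOn
    simp only [f, zero_add]
    rw [Set.projIcc_left, Set.projIcc_right]; exact h01
  have hval : ∀ t : I, AddCircle.liftIco 1 0 f ((t : ℝ) : AddCircle (1 : ℝ)) = F t := by
    intro t
    rcases t.2.2.lt_or_eq with h | h
    · rw [AddCircle.liftIco_coe_apply ⟨t.2.1, by simpa using h⟩]
      simp [f]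
    · have ht : t = 1 := Subtype.ext h
      have h0 : ((t : ℝ) : AddCircle (1 : ℝ)) = ((0 : ℝ) : AddCircle (1 : ℝ)) := by
        rw [h, AddCircle.coe_period]; simp
      rw [h0, AddCircle.liftIco_coe_apply ⟨le_rfl, by simp⟩, ht, ← h01]
      simp only [f]; rw [Set.projIcc_left]; rfl
  obtain ⟨S, w, hw, h⟩ := exists_fourier_approx ⟨_, hG⟩ hε
  refine ⟨S, w, fun n => Submodule.span_mono ?_ (hw n), fun t => ?_⟩
  · rintro _ ⟨a, rfl⟩
    induction a using QuotientAddGroup.induction_on with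
    | H a =>
      change AddCircle.liftIco 1 0 f _ ∈ _
      obtain ⟨b, hb, hab⟩ := (AddCircle.coe_image_Ico_eq (1 : ℝ) 0).symm ▸
        (Set.mem_univ ((a : ℝ) : AddCircle (1 : ℝ)))
      refine ⟨⟨b, hb.1, by simpa using hb.2.le⟩, ?_⟩
      rw [← hval]; exact congrArg _ hab
  · have := h ((t : ℝ) : AddCircle (1 : ℝ))
    simp only [ContinuousMap.coe_mk, hval] at this
    convert this using 6 with n hn
    rw [fourier_coe_apply, circ, ← Complex.exp_int_mul]
    congr 1
    push_cast; ring

end Approximation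

section Bott

attribute [local instance] Matrix.normedAddCommGroup Matrix.normedSpace

theorem Adm.exists_pos_htpc [CompactSpace X] {Y : Set X} {u : I × X → Matrix ι ι ℂ}
    (hu : Adm Y u) : ∃ ε > 0, ∀ v : I × X → Matrix ι ι ℂ, Continuous v →
      (∀ t, ∀ y ∈ Y, ∀ y' ∈ Y, v (t, y) = v (t, y')) → (∀ x, v (0, x) = v (1, x)) →
      (∀ z, ‖u z - v z‖ < ε) → Htpc Y u v := by
  have ho : IsOpen {A : Matrix ι ι ℂ | IsUnit A} := by
    have : {A : Matrix ι ι ℂ | IsUnit A} = Matrix.det ⁻¹' {0}ᶜ := by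
      ext A; simp [Matrix.isUnit_iff_isUnit_det]
    rw [this]
    exact isOpen_compl_singleton.preimage (continuous_id.matrix_det)
  obtain ⟨ε, hε, h⟩ := (isCompact_range hu.cont).exists_thickening_subset_open ho
    (by rintro _ ⟨z, rfl⟩; exact hu.unit z)
  refine ⟨ε, hε, fun v hv hY hl hd => ?_⟩
  refine ⟨fun p => u p.2 + ((p.1 : ℝ) : ℂ) • (v p.2 - u p.2), ?_, fun s => ⟨?_, ?_, ?_, ?_⟩, ?_, ?_⟩
  · have := hu.cont; fun_prop
  · have := hu.cont; fun_prop
  · intro z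
    refine h (Metric.mem_thickening_iff.2 ⟨u z, ⟨z, rfl⟩, ?_⟩)
    rw [dist_eq_norm, add_sub_cancel_left, norm_smul, Complex.norm_real, Real.norm_eq_abs,
      abs_of_nonneg s.2.1, norm_sub_rev]
    exact (mul_le_of_le_one_left (norm_nonneg _) s.2.2).trans_lt (hd z)
  · intro t y hy y' hy'
    simp only [hu.const t y hy y' hy', hY t y hy y' hy']
  · intro x
    simp only [hu.loop, hl]
  · intro z; simp
  · intro z; simp

theorem good_laurent {Y : Set X} (hYne : Y.Nonempty) (H : KZero X Y) (S : Finset ℤ)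
    (a : ℤ → X → Matrix ι ι ℂ) (ha : ∀ j, Continuous (a j))
    (haY : ∀ j, ∀ y ∈ Y, ∀ y' ∈ Y, a j y = a j y')
    (hu : ∀ z : I × X, IsUnit (∑ j ∈ S, circ z.1 ^ j • a j z.2)) :
    Good Y (fun z => ∑ j ∈ S, circ z.1 ^ j • a j z.2) := by
  classical
  obtain ⟨d, hd⟩ : ∃ d : ℕ, ∀ j ∈ S, j.natAbs < d :=
    ⟨S.sup Int.natAbs + 1, fun j hj => Nat.lt_succ_of_le (Finset.le_sup (f := Int.natAbs) hj)⟩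
  have key : ∀ z : I × X, circ z.1 ^ d • ∑ j ∈ S, circ z.1 ^ j • a j z.2
      = ∑ k ∈ Finset.range (2 * d + 2), circ z.1 ^ k •
        (if (k : ℤ) - d ∈ S then a ((k : ℤ) - d) z.2 else 0) := by
    intro z
    have h0 := circ_ne_zero (z.1 : ℝ)
    rw [Finset.smul_sum]
    simp only [smul_ite, smul_zero]
    rw [← Finset.sum_filter]
    refine Finset.sum_bij' (fun j _ => (j + d).toNat) (fun k _ => (k : ℤ) - d) ?_ ?_ ?_ ?_ ?_
    · intro j hj
      have := hd j hj
      rw [Finset.mem_filter, Finset.mem_range]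
      have h : (((j + d).toNat : ℕ) : ℤ) - d = j := by omega
      rw [h]
      exact ⟨by omega, hj⟩
    · intro k hk
      exact (Finset.mem_filter.1 hk).2
    · intro j hj
      have := hd j hj
      omega
    · intro k hk
      omega
    · intro j hj
      have := hd j hj
      have h : (((j + d).toNat : ℕ) : ℤ) - d = j := by omega
      simp only [h]
      rw [smul_smul, ← zpow_natCast, ← zpow_natCast, ← zpow_add₀ h0]
      congr 2; omega
  have hc := continuous_circ_coe
  have hu' : ∀ z : I × X, IsUnit (circ z.1 ^ d • ∑ j ∈ S, circ z.1 ^ j • a j z.2) := by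
    intro z
    have h0 : IsUnit (circ (z.1 : ℝ) ^ d) := (isUnit_iff_ne_zero.2 (circ_ne_zero _)).pow d
    rw [← h0.unit_spec]
    exact (hu z).smul h0.unit
  have G := good_polynomial hYne H (2 * d) ι
    (fun k x => if (k : ℤ) - d ∈ S then a ((k : ℤ) - d) x else 0)
    (fun k => by split_ifs; exacts [ha _, continuous_const])
    (fun k y hy y' hy' => by split_ifs; exacts [haY _ y hy y' hy', rfl])
    (fun z => by rw [← key]; exact hu' z)
  have G2 := G.mul_left (α := fun t : I => (circ t ^ d)⁻¹ • (1 : Matrix ι ι ℂ))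
    ((Continuous.inv₀ (hc.pow d) fun t => pow_ne_zero _ (circ_ne_zero _)).smul continuous_const)
    (fun t => by
      have h0 : IsUnit (circ (t : ℝ) ^ d)⁻¹ :=
        isUnit_iff_ne_zero.2 (inv_ne_zero (pow_ne_zero _ (circ_ne_zero _)))
      rw [← h0.unit_spec]
      exact isUnit_one.smul h0.unit)
    (by simp [circ_zero, circ_one])
  have e : (fun z : I × X => ∑ j ∈ S, circ z.1 ^ j • a j z.2) = fun z : I × X =>
      ((circ z.1 ^ d)⁻¹ • (1 : Matrix ι ι ℂ)) * ∑ k ∈ Finset.range (2 * d + 2), circ z.1 ^ k •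
        (if (k : ℤ) - d ∈ S then a ((k : ℤ) - d) z.2 else 0) := by
    funext z
    rw [← key, smul_mul_assoc, one_mul, smul_smul,
      inv_mul_cancel₀ (pow_ne_zero _ (circ_ne_zero _)), one_smul]
  rw [e]
  exact G2

theorem KZero.kOne [CompactSpace X] {Y : Set X} (hYne : Y.Nonempty) (H : KZero X Y) :
    KOne (I × X) (cylBd Y) := by
  intro ι _ _ u hu hunit h1
  refine Good.exists_contraction hYne h1 ?_
  have hadm : Adm Y u := by
    refine ⟨hu, hunit, fun t y hy y' hy' => ?_, fun x => ?_⟩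
    · rw [h1 (t, y) (Or.inr (Or.inr hy)), h1 (t, y') (Or.inr (Or.inr hy'))]
    · rw [h1 (0, x) (Or.inl rfl), h1 (1, x) (Or.inr (Or.inl rfl))]
  obtain ⟨ε, hε, hh⟩ := hadm.exists_pos_htpc
  let F : C(I, C(X, ι → ι → ℂ)) := ContinuousMap.curry ⟨u, hu⟩
  have hF : ∀ t x, F t x = u (t, x) := fun _ _ => rfl
  have h01 : F 0 = F 1 := ContinuousMap.ext fun x => hadm.loop x
  obtain ⟨S, w, hw, hd⟩ := exists_circ_approx F h01 hε
  have hwY : ∀ n, ∀ y ∈ Y, ∀ y' ∈ Y, w n y = w n y' := by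
    intro n y hy y' hy'
    refine Submodule.span_induction (p := fun (v : C(X, ι → ι → ℂ)) _ => v y = v y')
      ?_ ?_ ?_ ?_ (hw n)
    · rintro _ ⟨t, rfl⟩; exact hadm.const t y hy y' hy'
    · rfl
    · intro a b _ _ ha hb; simp [ha, hb]
    · intro c a _ ha; simp [ha]
  have hv : Htpc Y u (fun z : I × X => ∑ j ∈ S, circ z.1 ^ j • w j z.2) := by
    have hc : ∀ j : ℤ, Continuous fun z : I × X => circ z.1 ^ j := fun j =>
      (continuous_circ_coe.comp continuous_fst).zpow₀ j fun z => Or.inl (circ_ne_zero _)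
    refine hh _ ?_ ?_ ?_ ?_
    · exact continuous_finsetSum _ fun j _ => (hc j).smul
        ((w j).continuous.comp continuous_snd)
    · intro t y hy y' hy'
      exact Finset.sum_congr rfl fun j _ => by rw [hwY j y hy y' hy']
    · intro x
      refine Finset.sum_congr rfl fun j _ => ?_
      simp only [Set.Icc.coe_zero, Set.Icc.coe_one, circ_zero, circ_one]
      rfl
    · intro z
      refine lt_of_le_of_lt ?_ (hd z.1)
      have := ContinuousMap.norm_coe_le_norm (F z.1 - ∑ n ∈ S, circ z.1 ^ n • w n) z.2
      simp only [ContinuousMap.sub_apply, ContinuousMap.sum_apply, ContinuousMap.smul_apply,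
        hF] at this
      exact this
  exact Good.of_htpc hv (good_laurent hYne H S (fun j => w j) (fun j => (w j).continuous) hwY
    hv.adm_right.unit)

end Bott

end

section

variable {X Z : Type} [TopologicalSpace X] [TopologicalSpace Z]
variable {ι κ : Type} [Fintype ι] [DecidableEq ι] [Fintype κ] [DecidableEq κ]

theorem KOne.congr {Y : Set X} {W : Set Z} (H : KOne X Y) (φ : X ≃ₜ Z)
    (hφ : ∀ x, x ∈ Y ↔ φ x ∈ W) : KOne Z W := by
  intro ι _ _ u hu hunit h1
  obtain ⟨κ, _, _, h, hc, hh, hY, h0, h1⟩ := H ι (u ∘ φ) (hu.comp φ.continuous)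
    (fun x => hunit _) (fun y hy => h1 _ ((hφ y).1 hy))
  have hW : ∀ z ∈ W, φ.symm z ∈ Y := fun z hz => (hφ _).2 (by simpa using hz)
  refine ⟨κ, inferInstance, inferInstance, fun p => h (p.1, φ.symm p.2), ?_, fun z => hh _,
    fun t y hy => hY t _ (hW y hy), fun x => h0 _, fun x => ?_⟩
  · exact hc.comp (continuous_fst.prodMk (φ.symm.continuous.comp continuous_snd))
  · simp only [h1, Function.comp, Homeomorph.apply_symm_apply]

theorem KZero.congr {Y : Set X} {W : Set Z} (H : KZero X Y) (φ : X ≃ₜ Z)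
    (hφ : ∀ x, x ∈ Y ↔ φ x ∈ W) : KZero Z W := by
  intro ι _ _ e p he hee hp hY
  obtain ⟨κ, _, _, q, g, hq, hg, hgu, hgY, hgc⟩ := H ι (e ∘ φ) p (he.comp φ.continuous)
    (fun x => hee _) hp (fun y hy => hY _ ((hφ y).1 hy))
  have hW : ∀ z ∈ W, φ.symm z ∈ Y := fun z hz => (hφ _).2 (by simpa using hz)
  refine ⟨κ, inferInstance, inferInstance, q, g ∘ φ.symm, hq, hg.comp φ.symm.continuous,
    fun x => hgu _, fun y hy => hgY _ (hW y hy), fun x => ?_⟩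
  simpa using hgc (φ.symm x)

theorem exists_path_isUnit (A : Matrix ι ι ℂ) (hA : IsUnit A) :
    ∃ γ : I → Matrix ι ι ℂ, Continuous γ ∧ (∀ t, IsUnit (γ t)) ∧ γ 0 = 1 ∧ γ 1 = A := by
  let p : Polynomial ℂ := (1 + (Polynomial.X : Polynomial ℂ) • (A - 1).map Polynomial.C).det
  have hp : ∀ ζ, p.eval ζ = (1 + ζ • (A - 1)).det := by
    intro ζ
    have := (Polynomial.evalRingHom ζ).map_det
      (1 + (Polynomial.X : Polynomial ℂ) • (A - 1).map Polynomial.C)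
    rw [Polynomial.coe_evalRingHom] at this
    rw [this]
    congr 1
    ext i j
    by_cases hij : i = j
    · simp [hij]
    · simp [hij]; ring
  have hp0 : p ≠ 0 := by
    intro h
    have := hp 0
    simp [h] at this
  have hfin : (p.rootSet ℂ).Countable := (Polynomial.rootSet_finite p ℂ).countable
  have hpc := hfin.isPathConnected_compl_of_one_lt_rank (E := ℂ) (by simp)
  have hmem : ∀ ζ, ζ ∈ (p.rootSet ℂ)ᶜ ↔ IsUnit (1 + ζ • (A - 1)) := by
    intro ζ
    rw [Set.mem_compl_iff, Polynomial.mem_rootSet, Matrix.isUnit_iff_isUnit_det, ← hp]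
    simp [hp0]
  obtain ⟨γ, hγ⟩ := hpc.joinedIn 0 ((hmem 0).2 (by simp)) 1 ((hmem 1).2 (by simpa using hA))
  refine ⟨fun t => 1 + γ t • (A - 1), ?_, fun t => (hmem _).1 (hγ t), by simp, by simp⟩
  exact continuous_const.add (γ.continuous.smul continuous_const)

theorem kOne_of_subsingleton [Subsingleton X] : KOne X ∅ := by
  intro ι _ _ u hu hunit _
  rcases isEmpty_or_nonempty X with hX | ⟨⟨x₀⟩⟩
  · exact ⟨Empty, inferInstance, inferInstance, fun p => isEmptyElim p.2,
      continuous_of_const fun p => isEmptyElim p.2, fun p => isEmptyElim p.2,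
      fun _ y => isEmptyElim y, fun y => isEmptyElim y, fun y => isEmptyElim y⟩
  obtain ⟨γ, hγ, hγu, h0, h1⟩ := exists_path_isUnit (u x₀) (hunit x₀)
  refine ⟨Empty, inferInstance, inferInstance, fun p => stab Empty (γ p.1), ?_,
    fun z => isUnit_blockDiag (hγu _) isUnit_one, fun t y hy => hy.elim, fun x => ?_, fun x => ?_⟩
  · exact (hγ.comp continuous_fst).matrix_fromBlocks continuous_const continuous_const
      continuous_const
  · simp [h0, stab]
  · rw [Subsingleton.elim x x₀, ← h1]

/-- The cylinder over a cube is a cube. -/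
def consHomeomorph (m : ℕ) : I × (Fin m → I) ≃ₜ (Fin (m + 1) → I) where
  toFun z := Fin.cons z.1 z.2
  invFun x := (x 0, fun i => x i.succ)
  left_inv z := by simp
  right_inv x := by
    funext i
    refine Fin.cases ?_ (fun j => ?_) i <;> simp
  continuous_toFun := by
    refine continuous_pi fun i => Fin.cases ?_ (fun j => ?_) i
    · exact continuous_fst
    · exact (continuous_apply j).comp continuous_snd
  continuous_invFun := by fun_prop

/-- The boundary of the unit cube. -/
def cubeBd (m : ℕ) : Set (Fin m → I) := {x | ∃ i, x i = 0 ∨ x i = 1}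

theorem mem_cylBd_cubeBd (m : ℕ) (z : I × (Fin m → I)) :
    z ∈ cylBd (cubeBd m) ↔ consHomeomorph m z ∈ cubeBd (m + 1) := by
  simp [cylBd, cubeBd, consHomeomorph, Fin.exists_fin_succ, or_assoc]

theorem kOne_cube (k : ℕ) : KOne (Fin (2 * k) → I) (cubeBd (2 * k)) := by
  induction k with
  | zero =>
    have : cubeBd (2 * 0) = ∅ := by
      ext x; simp [cubeBd]
    rw [this]
    have : Subsingleton (Fin (2 * 0) → I) := ⟨fun a b => funext fun i => i.elim0⟩
    exact kOne_of_subsingleton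
  | succ k ih =>
    have h1 := ih.kZero.congr (consHomeomorph _) (mem_cylBd_cubeBd _)
    have hne : (cubeBd (2 * k + 1)).Nonempty := ⟨fun _ => 0, 0, Or.inl rfl⟩
    exact (h1.kOne hne).congr (consHomeomorph _) (mem_cylBd_cubeBd _)

theorem kZero_cube (k : ℕ) : KZero (Fin (2 * k + 1) → I) (cubeBd (2 * k + 1)) :=
  (kOne_cube k).kZero.congr (consHomeomorph _) (mem_cylBd_cubeBd _)

end

section

variable {X Z : Type} [TopologicalSpace X] [TopologicalSpace Z]
variable {ι κ : Type} [Fintype ι] [DecidableEq ι] [Fintype κ] [DecidableEq κ]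

theorem KZero.of_quotient [CompactSpace X] [T2Space Z] {Y : Set X} (H : KZero X Y) {q : X → Z}
    (hq : Continuous q) (hs : Function.Surjective q)
    (hf : ∀ x x', q x = q x' → x = x' ∨ (x ∈ Y ∧ x' ∈ Y)) : KZero Z (q '' Y) := by
  intro ι _ _ e p he hee hp hY
  obtain ⟨κ, _, _, r, g, hr, hg, hgu, hgY, hgc⟩ := H ι (e ∘ q) p (he.comp hq)
    (fun x => hee _) hp (fun y hy => hY _ ⟨y, hy, rfl⟩)
  have hG : ∀ x, g (Function.surjInv hs (q x)) = g x := by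
    intro x
    rcases hf _ _ (Function.surjInv_eq hs (q x)) with h | ⟨h, h'⟩
    · rw [h]
    · rw [hgY _ h, hgY _ h']
  have hQ : IsQuotientMap q := IsQuotientMap.of_surjective_continuous hs hq
  refine ⟨κ, inferInstance, inferInstance, r, fun z => g (Function.surjInv hs z), hr, ?_,
    fun _ => hgu _, ?_, fun z => ?_⟩
  · rw [hQ.continuous_iff]
    exact hg.congr fun x => (hG x).symm
  · rintro _ ⟨y, hy, rfl⟩
    simp only [hG]; exact hgY y hy
  · obtain ⟨x, rfl⟩ := hs z
    simp only [hG]; exact hgc x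

/-- Centered coordinates on the unit cube. -/
def centered {m : ℕ} (x : Fin m → I) : Fin m → ℝ := fun i => 2 * x i - 1

theorem continuous_centered {m : ℕ} : Continuous (centered (m := m)) := by
  unfold centered; fun_prop

theorem norm_centered_le {m : ℕ} (x : Fin m → I) : ‖centered x‖ ≤ 1 := by
  refine (pi_norm_le_iff_of_nonneg zero_le_one).2 fun i => ?_
  rw [Real.norm_eq_abs, abs_le]
  have h0 := (x i).2.1
  have h1 := (x i).2.2
  constructor <;> simp only [centered] <;> linarith

theorem centered_injective {m : ℕ} : Function.Injective (centered (m := m)) := by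
  intro x y h
  funext i
  have := congrFun h i
  simp only [centered] at this
  exact Subtype.ext (by linarith)

theorem mem_cubeBd_iff {m : ℕ} (x : Fin (m + 1) → I) : x ∈ cubeBd (m + 1) ↔ ‖centered x‖ = 1 := by
  constructor
  · rintro ⟨i, hi⟩
    refine le_antisymm (norm_centered_le x) ?_
    refine le_trans ?_ (norm_le_pi_norm (centered x) i)
    rcases hi with hi | hi <;> (simp [centered, hi]; try norm_num)
  · intro h
    obtain ⟨i, hi⟩ : ∃ i, ‖centered x i‖ = ‖centered x‖ := by
      obtain ⟨i, -, hi⟩ := Finset.exists_max_image Finset.univ (fun i => ‖centered x i‖)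
        Finset.univ_nonempty
      exact ⟨i, le_antisymm (norm_le_pi_norm _ i)
        ((pi_norm_le_iff_of_nonneg (norm_nonneg _)).2 fun j => hi j (Finset.mem_univ _))⟩
    refine ⟨i, ?_⟩
    rw [h, Real.norm_eq_abs] at hi
    rcases (abs_eq zero_le_one).1 hi with h' | h' <;> simp only [centered] at h'
    · exact Or.inr (Subtype.ext (by rw [Set.Icc.coe_one]; linarith))
    · exact Or.inl (Subtype.ext (by rw [Set.Icc.coe_zero]; linarith))

/-- The sum of squares of a real vector. -/
def sumSq {m : ℕ} (c : Fin m → ℝ) : ℝ := ∑ i, c i ^ 2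

theorem sumSq_nonneg {m : ℕ} (c : Fin m → ℝ) : 0 ≤ sumSq c :=
  Finset.sum_nonneg fun _ _ => sq_nonneg _

theorem collapse_denom_pos {m : ℕ} (c : Fin m → ℝ) : 0 < sumSq c + (1 - ‖c‖) ^ 2 := by
  rcases (sumSq_nonneg c).lt_or_eq with h | h
  · positivity
  · have : c = 0 := by
      funext i
      have := (Finset.sum_eq_zero_iff_of_nonneg fun i _ => sq_nonneg (c i)).1 h.symm i
        (Finset.mem_univ _)
      simpa using this
    simp [this, sumSq]

/-- The map collapsing the complement of the open unit ball (for the sup norm) onto a pole of the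
sphere. -/
noncomputable def collapseVec {m : ℕ} (c : Fin m → ℝ) : EuclideanSpace ℝ (Fin (m + 1)) :=
  WithLp.toLp 2 (Fin.cons ((sumSq c - (1 - ‖c‖) ^ 2) / (sumSq c + (1 - ‖c‖) ^ 2))
    (fun i => 2 * (1 - ‖c‖) * c i / (sumSq c + (1 - ‖c‖) ^ 2)))

theorem collapseVec_mem {m : ℕ} (c : Fin m → ℝ) : collapseVec c ∈ Sph m := by
  have hD := (collapse_denom_pos c).ne'
  rw [Sph, mem_sphere_zero_iff_norm, ← sq_eq_sq₀ (norm_nonneg _) zero_le_one,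
    EuclideanSpace.real_norm_sq_eq, Fin.sum_univ_succ]
  simp only [collapseVec, Fin.cons_zero, Fin.cons_succ]
  have : ∑ i, (2 * (1 - ‖c‖) * c i / (sumSq c + (1 - ‖c‖) ^ 2)) ^ 2
      = 4 * (1 - ‖c‖) ^ 2 * sumSq c / (sumSq c + (1 - ‖c‖) ^ 2) ^ 2 := by
    conv_rhs => rw [sumSq]
    rw [Finset.mul_sum, Finset.sum_div]
    refine Finset.sum_congr rfl fun i _ => ?_
    rw [div_pow]; congr 1
    ring
  rw [this]
  field_simp
  ring

theorem continuous_collapseVec {m : ℕ} : Continuous (collapseVec (m := m)) := by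
  have h1 : Continuous fun c : Fin m → ℝ => sumSq c := by unfold sumSq; fun_prop
  have h2 : ∀ c : Fin m → ℝ, sumSq c + (1 - ‖c‖) ^ 2 ≠ 0 := fun c => (collapse_denom_pos c).ne'
  refine (PiLp.continuous_toLp 2 _).comp (continuous_pi fun i => Fin.cases ?_ (fun j => ?_) i)
  · simp only [Fin.cons_zero]
    exact Continuous.div (by fun_prop) (by fun_prop) h2
  · simp only [Fin.cons_succ]
    exact Continuous.div (by fun_prop) (by fun_prop) h2

/-- The quotient map from the cube to the sphere collapsing the boundary. -/
noncomputable def collapse (m : ℕ) (x : Fin m → I) : Sph m :=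
  ⟨collapseVec (centered x), collapseVec_mem _⟩

theorem continuous_collapse (m : ℕ) : Continuous (collapse m) :=
  (continuous_collapseVec.comp continuous_centered).subtype_mk _

theorem collapse_apply_zero {m : ℕ} (x : Fin m → I) :
    (1 - (collapse m x : EuclideanSpace ℝ (Fin (m + 1))) 0) *
      (sumSq (centered x) + (1 - ‖centered x‖) ^ 2) = 2 * (1 - ‖centered x‖) ^ 2 := by
  have := (collapse_denom_pos (centered x)).ne'
  simp only [collapse, collapseVec, Fin.cons_zero]
  field_simp; ring

theorem collapse_apply_succ {m : ℕ} (x : Fin m → I) (i : Fin m) :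
    (collapse m x : EuclideanSpace ℝ (Fin (m + 1))) i.succ *
      (sumSq (centered x) + (1 - ‖centered x‖) ^ 2) = 2 * (1 - ‖centered x‖) * centered x i := by
  have := (collapse_denom_pos (centered x)).ne'
  simp only [collapse, collapseVec, Fin.cons_succ]
  field_simp

theorem collapse_eq {m : ℕ} (x y : Fin (m + 1) → I) (h : collapse (m + 1) x = collapse (m + 1) y) :
    x = y ∨ (x ∈ cubeBd (m + 1) ∧ y ∈ cubeBd (m + 1)) := by
  have hx0 := collapse_apply_zero x
  have hy0 := collapse_apply_zero y
  have hx1 := collapse_apply_succ x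
  have hy1 := collapse_apply_succ y
  rw [h] at hx0 hx1
  have hDx := collapse_denom_pos (centered x)
  have hDy := collapse_denom_pos (centered y)
  have hxn := norm_centered_le x
  have hyn := norm_centered_le y
  rw [mem_cubeBd_iff, mem_cubeBd_iff]
  generalize hs : (collapse (m + 1) y : EuclideanSpace ℝ (Fin (m + 1 + 1))) = v at *
  by_cases hv : v 0 = 1
  · right
    constructor
    · have : 2 * (1 - ‖centered x‖) ^ 2 = 0 := by rw [← hx0, hv]; ring
      have : 1 - ‖centered x‖ = 0 := by simpa using this
      linarith
    · have : 2 * (1 - ‖centered y‖) ^ 2 = 0 := by rw [← hy0, hv]; ring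
      have : 1 - ‖centered y‖ = 0 := by simpa using this
      linarith
  · left
    have key : ∀ z : Fin (m + 1) → I, (1 - v 0) * (sumSq (centered z) + (1 - ‖centered z‖) ^ 2)
        = 2 * (1 - ‖centered z‖) ^ 2 →
        (∀ i, v i.succ * (sumSq (centered z) + (1 - ‖centered z‖) ^ 2)
          = 2 * (1 - ‖centered z‖) * centered z i) →
        0 < sumSq (centered z) + (1 - ‖centered z‖) ^ 2 → 1 - ‖centered z‖ ≠ 0 ∧
        centered z = (1 - ‖centered z‖) • fun i => v (Fin.succ i) / (1 - v 0) := by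
      intro z h0 h1 hD
      have hv' : 1 - v 0 ≠ 0 := fun h => hv (by linarith)
      have hr : 1 - ‖centered z‖ ≠ 0 := by
        intro h
        rw [h] at h0
        rcases mul_eq_zero.1 (h0.trans (by ring)) with h' | h'
        · exact hv' h'
        · rw [h] at hD; exact hD.ne' h'
      refine ⟨hr, funext fun i => ?_⟩
      simp only [Pi.smul_apply, smul_eq_mul]
      have h2 : (1 - ‖centered z‖) * (v i.succ) * (sumSq (centered z) + (1 - ‖centered z‖) ^ 2) =
          (1 - v 0) * centered z i * (sumSq (centered z) + (1 - ‖centered z‖) ^ 2) := by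
        rw [mul_assoc, h1 i]
        linear_combination (-centered z i) * h0
      have h3 := mul_right_cancel₀ hD.ne' h2
      rw [← mul_div_assoc, h3]
      field_simp
    obtain ⟨hrx, hcx⟩ := key x hx0 hx1 hDx
    obtain ⟨hry, hcy⟩ := key y hy0 hy1 hDy
    set w : Fin (m + 1) → ℝ := fun i => v (Fin.succ i) / (1 - v 0)
    have hn : ∀ z : Fin (m + 1) → I, ‖centered z‖ ≤ 1 →
        centered z = (1 - ‖centered z‖) • w → (1 - ‖centered z‖) * (1 + ‖w‖) = 1 := by
      intro z hz h
      have := congrArg norm h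
      rw [norm_smul, Real.norm_eq_abs, abs_of_nonneg (by linarith)] at this
      linarith
    have hw : (1 + ‖w‖) ≠ 0 := by positivity
    have : 1 - ‖centered x‖ = 1 - ‖centered y‖ :=
      mul_right_cancel₀ hw ((hn x hxn hcx).trans (hn y hyn hcy).symm)
    exact centered_injective (by rw [hcx, this, ← hcy])

theorem collapse_surjective (m : ℕ) : Function.Surjective (collapse (m + 1)) := by
  intro v
  have hv : (v : EuclideanSpace ℝ (Fin (m + 1 + 1))) 0 ^ 2
      + ∑ i : Fin (m + 1), (v : EuclideanSpace ℝ (Fin (m + 1 + 1))) i.succ ^ 2 = 1 := by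
    have h : (v : EuclideanSpace ℝ (Fin (m + 1 + 1))) ∈
      Metric.sphere (0 : EuclideanSpace ℝ (Fin (m + 1 + 1))) 1 := v.2
    rw [mem_sphere_zero_iff_norm, ← sq_eq_sq₀ (norm_nonneg _) zero_le_one,
      EuclideanSpace.real_norm_sq_eq, Fin.sum_univ_succ] at h
    simpa using h
  have huncenter : ∀ c : Fin (m + 1) → ℝ, ‖c‖ ≤ 1 → ∃ x, centered x = c := by
    intro c hc
    have hci : ∀ i, |c i| ≤ 1 := fun i => (norm_le_pi_norm c i).trans hc
    refine ⟨fun i => ⟨(c i + 1) / 2, ?_, ?_⟩, ?_⟩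
    · have := (abs_le.1 (hci i)).1; linarith
    · have := (abs_le.1 (hci i)).2; linarith
    · funext i; simp only [centered]; ring
  obtain ⟨v, hvm⟩ := v
  simp only at hv
  suffices h : ∃ c : Fin (m + 1) → ℝ, ‖c‖ ≤ 1 ∧ collapseVec c = v by
    obtain ⟨c, hc, h⟩ := h
    obtain ⟨x, rfl⟩ := huncenter c hc
    exact ⟨x, Subtype.ext h⟩
  by_cases h0 : v 0 = 1
  · refine ⟨fun _ => 1, by simp, ?_⟩
    have hz : ∀ i : Fin (m + 1), v i.succ = 0 := by
      have : ∑ i : Fin (m + 1), v i.succ ^ 2 = 0 := by rw [h0] at hv; linarith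
      intro i
      have := (Finset.sum_eq_zero_iff_of_nonneg fun i _ => sq_nonneg (v (Fin.succ i))).1 this i
        (Finset.mem_univ _)
      simpa using this
    ext i
    refine Fin.cases ?_ (fun j => ?_) i
    · have : sumSq (fun _ : Fin (m + 1) => (1 : ℝ)) ≠ 0 := by
        simp [sumSq]; positivity
      simp [collapseVec, h0, this]
    · simp [collapseVec, hz]
  · have hv' : 1 - v 0 ≠ 0 := fun h => h0 (by linarith)
    let w : Fin (m + 1) → ℝ := fun i => v (Fin.succ i) / (1 - v 0)
    have hw : 0 < 1 + ‖w‖ := by positivity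
    have hcn : ‖(1 + ‖w‖)⁻¹ • w‖ = (1 + ‖w‖)⁻¹ * ‖w‖ := by
      rw [norm_smul, norm_inv, Real.norm_eq_abs, abs_of_pos hw]
    have hρ : 1 - ‖(1 + ‖w‖)⁻¹ • w‖ = (1 + ‖w‖)⁻¹ := by
      rw [hcn]; field_simp; ring
    have hA : sumSq ((1 + ‖w‖)⁻¹ • w) = (1 + ‖w‖)⁻¹ ^ 2 * ((1 + v 0) / (1 - v 0)) := by
      have hw2 : ∑ i, w i ^ 2 = (1 + v 0) / (1 - v 0) := by
        simp only [w, div_pow]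
        rw [← Finset.sum_div, eq_sub_of_add_eq' hv]
        field_simp; ring
      rw [← hw2, sumSq, Finset.mul_sum]
      exact Finset.sum_congr rfl fun i _ => by simp only [Pi.smul_apply, smul_eq_mul]; ring
    have hD : sumSq ((1 + ‖w‖)⁻¹ • w) + (1 + ‖w‖)⁻¹ ^ 2 = (1 + ‖w‖)⁻¹ ^ 2 * (2 / (1 - v 0)) := by
      rw [hA]; field_simp; ring
    refine ⟨(1 + ‖w‖)⁻¹ • w, ?_, ?_⟩
    · have : 0 < (1 + ‖w‖)⁻¹ := by positivity
      linarith
    · ext i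
      refine Fin.cases ?_ (fun j => ?_) i
      · simp only [collapseVec, Fin.cons_zero, hρ]
        rw [hD, hA]
        field_simp; ring
      · simp only [collapseVec, Fin.cons_succ, hρ]
        rw [hD]
        simp only [Pi.smul_apply, smul_eq_mul, w]
        field_simp

/-- The functor `KZero` vanishes on an odd-dimensional sphere relative to the point to which the
boundary of the cube is collapsed. -/
theorem kZero_sphere (k : ℕ) : ∃ P : Sph (2 * k + 1), KZero (Sph (2 * k + 1)) {P} := by
  refine ⟨collapse (2 * k + 1) fun _ => 0, ?_⟩
  have h := (kZero_cube k).of_quotient (continuous_collapse _) (collapse_surjective _) collapse_eq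
  have : collapse (2 * k + 1) '' cubeBd (2 * k + 1) = {collapse (2 * k + 1) fun _ => 0} := by
    have hb : ∀ x ∈ cubeBd (2 * k + 1), collapse (2 * k + 1) x =
        ⟨WithLp.toLp 2 (Fin.cons 1 0), by
          simp [Sph, EuclideanSpace.norm_eq, Fin.sum_univ_succ]⟩ := by
      intro x hx
      have hx1 := (mem_cubeBd_iff x).1 hx
      have hD := (collapse_denom_pos (centered x)).ne'
      rw [hx1] at hD
      refine Subtype.ext ?_
      ext i
      refine Fin.cases ?_ (fun j => ?_) i
      · simp only [collapse, collapseVec, Fin.cons_zero, hx1]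
        field_simp; ring
      · simp [collapse, collapseVec, hx1]
    have h0 : (fun _ => 0 : Fin (2 * k + 1) → I) ∈ cubeBd (2 * k + 1) := ⟨0, Or.inl rfl⟩
    ext z
    constructor
    · rintro ⟨x, hx, rfl⟩
      rw [Set.mem_singleton_iff, hb x hx, hb _ h0]
    · rintro rfl
      exact ⟨_, h0, rfl⟩
  rwa [this] at h

end

section

variable {X Z : Type} [TopologicalSpace X] [TopologicalSpace Z]
variable {ι κ : Type} [Fintype ι] [DecidableEq ι] [Fintype κ] [DecidableEq κ]

/-- Two families of vectors related by a family of invertible matrices. -/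
def VecRel (p q : X → ι → ℂ) : Prop :=
  ∃ a : X → Matrix ι ι ℂ, Continuous a ∧ (∀ x, IsUnit (a x)) ∧ ∀ x, a x *ᵥ p x = q x

theorem VecRel.trans {p q r : X → ι → ℂ} (h : VecRel p q) (h' : VecRel q r) : VecRel p r := by
  obtain ⟨a, ha, hau, hapq⟩ := h
  obtain ⟨b, hb, hbu, hbqr⟩ := h'
  exact ⟨fun x => b x * a x, hb.mul ha, fun x => (hbu x).mul (hau x), fun x => by
    rw [← mulVec_mulVec, hapq, hbqr]⟩

theorem VecRel.symm {p q : X → ι → ℂ} (h : VecRel p q) : VecRel q p := by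
  obtain ⟨a, ha, hau, hapq⟩ := h
  exact ⟨fun x => (a x)⁻¹, continuous_matrix_inv ha hau, fun x => isUnit_inv_of_isUnit (hau x),
    fun x => by rw [← hapq, mulVec_mulVec, inv_mul_of_isUnit (hau x), one_mulVec]⟩

theorem VecRel.of_dual {p q φ : X → ι → ℂ} (hp : Continuous p) (hq : Continuous q)
    (hφ : Continuous φ) (h1 : ∀ x, φ x ⬝ᵥ p x ≠ 0) (h2 : ∀ x, φ x ⬝ᵥ q x ≠ 0) : VecRel p q := by
  have hφp : Continuous fun x => φ x ⬝ᵥ p x := hφ.dotProduct hp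
  refine ⟨fun x => 1 + vecMulVec (q x - p x) ((φ x ⬝ᵥ p x)⁻¹ • φ x), ?_, fun x => ?_, fun x => ?_⟩
  · exact continuous_const.add
      ((hq.sub hp).matrix_vecMulVec ((hφp.inv₀ h1).smul hφ))
  · simp only
    rw [Matrix.isUnit_iff_isUnit_det, isUnit_iff_ne_zero, vecMulVec_eq (Fin 1),
      det_one_add_replicateCol_mul_replicateRow, smul_dotProduct, dotProduct_sub, smul_eq_mul,
      mul_sub, inv_mul_cancel₀ (h1 x), add_sub_cancel]
    exact mul_ne_zero (inv_ne_zero (h1 x)) (h2 x)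
  · rw [add_mulVec, one_mulVec, vecMulVec_mulVec, smul_dotProduct, smul_eq_mul,
      inv_mul_cancel₀ (h1 x)]
    simp

open scoped ComplexOrder in
theorem star_dotProduct_self_ne_zero {v : ι → ℂ} (hv : v ≠ 0) : star v ⬝ᵥ v ≠ 0 :=
  fun h => hv (dotProduct_star_self_eq_zero.1 h)

theorem VecRel.add_right {p q : X → ι → ℂ} (hp : Continuous p) (hq : Continuous q)
    (h0 : ∀ x, q x ≠ 0) (h : ∀ x (c : ℂ), p x ≠ c • q x) : VecRel p (fun x => p x + q x) := by
  let t : X → ι → ℂ := fun x => (star (q x) ⬝ᵥ q x) • p x - (star (q x) ⬝ᵥ p x) • q x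
  have ht : Continuous t := ((hq.star.dotProduct hq).smul hp).sub ((hq.star.dotProduct hp).smul hq)
  have htq : ∀ x, star (t x) ⬝ᵥ q x = 0 := by
    intro x
    simp only [t, star_sub, star_smul, sub_dotProduct, smul_dotProduct, smul_eq_mul]
    rw [← star_dotProduct (q x) (q x), ← star_dotProduct (p x) (q x)]
    ring
  have htp : ∀ x, star (t x) ⬝ᵥ p x ≠ 0 := by
    intro x hx
    have h1 : t x ≠ 0 := by
      intro h1
      refine h x ((star (q x) ⬝ᵥ q x)⁻¹ * (star (q x) ⬝ᵥ p x)) ?_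
      rw [mul_smul, ← sub_eq_zero.1 h1, smul_smul,
        inv_mul_cancel₀ (star_dotProduct_self_ne_zero (h0 x)), one_smul]
    apply star_dotProduct_self_ne_zero h1
    conv_lhs => rw [show t x = (star (q x) ⬝ᵥ q x) • p x - (star (q x) ⬝ᵥ p x) • q x from rfl]
    change star (t x) ⬝ᵥ _ = 0
    rw [dotProduct_sub, dotProduct_smul, dotProduct_smul, hx, htq]
    simp
  exact VecRel.of_dual hp (hp.add hq) ht.star htp fun x => by
    rw [dotProduct_add, htq, add_zero]; exact htp x

theorem VecRel.of_const {v w : ι → ℂ} (hv : v ≠ 0) (hw : w ≠ 0) :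
    VecRel (fun _ : X => v) (fun _ => w) := by
  by_cases h : star v ⬝ᵥ w = 0
  · have h' : star w ⬝ᵥ v = 0 := by
      rw [star_dotProduct, h, star_zero]
    refine VecRel.of_dual (φ := fun _ => star v + star w) continuous_const continuous_const
      continuous_const (fun _ => ?_) fun _ => ?_
    · rw [add_dotProduct, h', add_zero]; exact star_dotProduct_self_ne_zero hv
    · rw [add_dotProduct, h, zero_add]; exact star_dotProduct_self_ne_zero hw
  · exact VecRel.of_dual (φ := fun _ => star v) continuous_const continuous_const
      continuous_const (fun _ => star_dotProduct_self_ne_zero hv) fun _ => h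

theorem exists_close_vecRel [CompactSpace X] {s : X → ι → ℂ} (hs : Continuous s)
    (h0 : ∀ x, s x ≠ 0) : ∃ ε > 0, ∀ s' : X → ι → ℂ, Continuous s' →
      (∀ x, ‖s' x - s x‖ < ε) → (∀ x, s' x ≠ 0) ∧ VecRel s s' := by
  rcases isEmpty_or_nonempty X with hX | hX
  · exact ⟨1, one_pos, fun s' hs' _ => ⟨fun x => isEmptyElim x, fun _ => 1, continuous_const,
      fun x => isEmptyElim x, fun x => isEmptyElim x⟩⟩
  let F : X → ℝ := fun x => (∑ i, ‖s x i‖ ^ 2) / (1 + ∑ i, ‖s x i‖)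
  have hden : ∀ x, 0 < 1 + ∑ i, ‖s x i‖ := fun x => by positivity
  have hF : Continuous F := Continuous.div (by fun_prop) (by fun_prop) fun x => (hden x).ne'
  have hFpos : ∀ x, 0 < F x := by
    intro x
    refine div_pos ?_ (hden x)
    obtain ⟨i, hi⟩ := Function.ne_iff.1 (h0 x)
    refine Finset.sum_pos' (fun _ _ => sq_nonneg _) ⟨i, Finset.mem_univ _, ?_⟩
    have : 0 < ‖s x i‖ := norm_pos_iff.2 hi
    positivity
  obtain ⟨x₀, -, hx₀⟩ := isCompact_univ.exists_isMinOn Set.univ_nonempty hF.continuousOn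
  replace hx₀ : ∀ x, F x₀ ≤ F x := fun x => hx₀ (Set.mem_univ x)
  refine ⟨F x₀, hFpos x₀, fun s' hs' hd => ?_⟩
  have key : ∀ x, star (s x) ⬝ᵥ s' x ≠ 0 := by
    intro x h
    have h1 : star (s x) ⬝ᵥ (s' x - s x) = -((∑ i, ‖s x i‖ ^ 2 : ℝ) : ℂ) := by
      rw [dotProduct_sub, h, zero_sub, dotProduct]
      congr 1
      push_cast
      refine Finset.sum_congr rfl fun i _ => ?_
      rw [Pi.star_apply, RCLike.star_def, Complex.conj_mul']
    have h2 : ‖star (s x) ⬝ᵥ (s' x - s x)‖ ≤ (∑ i, ‖s x i‖) * F x := by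
      rw [dotProduct, Finset.sum_mul]
      refine norm_sum_le_of_le _ fun i _ => ?_
      rw [norm_mul, Pi.star_apply, norm_star]
      gcongr
      exact (norm_le_pi_norm (s' x - s x) i).trans ((hd x).le.trans (hx₀ x))
    rw [h1, norm_neg, Complex.norm_real, Real.norm_eq_abs] at h2
    have h3 := (le_abs_self _).trans h2
    have h4 : (∑ i, ‖s x i‖ ^ 2) = F x * (1 + ∑ i, ‖s x i‖) := by
      simp only [F]; field_simp
    rw [h4] at h3
    nlinarith [hFpos x]
  refine ⟨fun x h => key x (by rw [h, dotProduct_zero]), ?_⟩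
  exact VecRel.of_dual hs hs' hs.star (fun x => star_dotProduct_self_ne_zero (h0 x)) key

section Sphere

variable {E : Type} [NormedAddCommGroup E] [InnerProductSpace ℝ E] [FiniteDimensional ℝ E]

theorem exists_notMem_lines {g : E → ι → ℂ} (hg : ContDiff ℝ 1 g)
    (hdim : Module.finrank ℝ E + 1 < 2 * Fintype.card ι) :
    ∃ v : ι → ℂ, v ≠ 0 ∧ ∀ y ∈ Metric.sphere (0 : E) 1, ∀ c : ℂ, v ≠ c • g y := by
  let Φ : E × ℝ → ι → ℂ := fun z =>
    ((‖z.1‖ : ℂ) * Complex.exp (z.2 * Complex.I)) • g (‖z.1‖⁻¹ • z.1)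
  let U : Set (E × ℝ) := {z | z.1 ≠ 0}
  have hΦ : ∀ z ∈ U, ContDiffAt ℝ 1 Φ z := by
    intro z hz
    have h1 : ContDiffAt ℝ 1 (fun z : E × ℝ => ‖z.1‖) z := (contDiffAt_fst).norm ℝ hz
    have h2 : ContDiffAt ℝ 1 (fun z : E × ℝ => (‖z.1‖ : ℂ)) z :=
      Complex.ofRealCLM.contDiff.contDiffAt.comp z h1
    have h3 : ContDiffAt ℝ 1 (fun z : E × ℝ => Complex.exp (z.2 * Complex.I)) z :=
      ((Complex.ofRealCLM.contDiff.contDiffAt.comp z contDiffAt_snd).mul contDiffAt_const).cexp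
    have h4 : ContDiffAt ℝ 1 (fun z : E × ℝ => g (‖z.1‖⁻¹ • z.1)) z :=
      hg.contDiffAt.comp z ((h1.inv (norm_ne_zero_iff.2 hz)).smul contDiffAt_fst)
    exact (h2.mul h3).smul h4
  have hd1 : dimH (Φ '' U) ≤ Module.finrank ℝ E + 1 := by
    calc dimH (Φ '' U) ≤ dimH U := by
          refine dimH_image_le_of_locally_lipschitzOn fun z hz => ?_
          obtain ⟨K, t, ht, hK⟩ := (hΦ z hz).exists_lipschitzOnWith
          exact ⟨K, t, mem_nhdsWithin_of_mem_nhds ht, hK⟩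
      _ ≤ dimH (Set.univ : Set (E × ℝ)) := dimH_mono (Set.subset_univ _)
      _ = Module.finrank ℝ E + 1 := by
          rw [Real.dimH_univ_eq_finrank]; simp
  have hd2 : dimH (Φ '' U ∪ {0}) < dimH (Set.univ : Set (ι → ℂ)) := by
    rw [dimH_union, dimH_singleton, Real.dimH_univ_eq_finrank]
    have : Module.finrank ℝ (ι → ℂ) = 2 * Fintype.card ι := by
      rw [Module.finrank_pi_fintype]; simp [Complex.finrank_real_complex, mul_comm]
    rw [this]
    refine max_lt (hd1.trans_lt (by exact_mod_cast hdim)) ?_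
    exact_mod_cast (by omega : 0 < 2 * Fintype.card ι)
  obtain ⟨v, hv⟩ : ∃ v, v ∉ Φ '' U ∪ {0} := by
    by_contra! h
    rw [Set.eq_univ_of_forall h] at hd2
    exact lt_irrefl _ hd2
  rw [Set.mem_union, not_or] at hv
  refine ⟨v, hv.2, fun y hy c hc => ?_⟩
  have hy1 : ‖y‖ = 1 := by simpa using hy
  have hc0 : c ≠ 0 := by
    rintro rfl
    exact hv.2 (by simpa using hc)
  refine hv.1 ⟨(‖c‖ • y, c.arg), ?_, ?_⟩
  · have : y ≠ 0 := by rintro rfl; simp at hy1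
    exact smul_ne_zero (norm_ne_zero_iff.2 hc0) this
  · have hn : ‖‖c‖ • y‖ = ‖c‖ := by rw [norm_smul, norm_norm, hy1, mul_one]
    simp only [Φ, hn, Complex.norm_mul_exp_arg_mul_I, smul_smul,
      inv_mul_cancel₀ (norm_ne_zero_iff.2 hc0), one_smul]
    exact hc.symm

theorem exists_completion (hdim : Module.finrank ℝ E + 1 < 2 * Fintype.card ι)
    {s : Metric.sphere (0 : E) 1 → ι → ℂ} (hs : Continuous s) (h0 : ∀ x, s x ≠ 0) {w : ι → ℂ}
    (hw : w ≠ 0) : VecRel (fun _ => w) s := by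
  obtain ⟨ε, hε, hclose⟩ := exists_close_vecRel hs h0
  obtain ⟨G, hG⟩ := ContinuousMap.exists_restrict_eq
    (Metric.isClosed_sphere (x := (0 : E)) (ε := 1))
    (⟨s, hs⟩ : C(Metric.sphere (0 : E) 1, ι → ℂ))
  obtain ⟨g, hg, hd, -⟩ := G.continuous.exists_contDiff_approx 1 (ε := fun _ => ε)
    continuous_const fun _ => hε
  have hGs : ∀ x : Metric.sphere (0 : E) 1, G x = s x := fun x => DFunLike.congr_fun hG x
  have hgc : Continuous fun x : Metric.sphere (0 : E) 1 => g x :=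
    hg.continuous.comp continuous_subtype_val
  obtain ⟨hg0, hsg⟩ := hclose (fun x => g x) hgc fun x => by
    rw [← dist_eq_norm, ← hGs]; exact hd x
  obtain ⟨v, hv0, hv⟩ := exists_notMem_lines (g := g) (by exact_mod_cast hg) hdim
  have h1 : VecRel (fun x : Metric.sphere (0 : E) 1 => g x) (fun x => g x + v) :=
    VecRel.add_right hgc continuous_const (fun _ => hv0) fun x c hc => by
      have hc0 : c ≠ 0 := by
        rintro rfl
        exact hg0 x (by simpa using hc)
      exact hv x x.2 c⁻¹ (by rw [hc, smul_smul, inv_mul_cancel₀ hc0, one_smul])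
  have h2 : VecRel (fun _ : Metric.sphere (0 : E) 1 => v) (fun x => v + g x) :=
    VecRel.add_right continuous_const hgc hg0 fun x c => hv x x.2 c
  simp only [add_comm v] at h2
  exact (VecRel.of_const hw hv0).trans (h2.trans (h1.symm.trans hsg.symm))

end Sphere

end

section

variable {X Z : Type} [TopologicalSpace X] [TopologicalSpace Z]
variable {ι κ : Type} [Fintype ι] [DecidableEq ι] [Fintype κ] [DecidableEq κ]
variable {ρ τ : Type} [Fintype ρ] [DecidableEq ρ] [Fintype τ] [DecidableEq τ]

/-- The image bundle of the idempotent family `e` has a global frame indexed by `ρ`. -/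
def Free (e : X → Matrix ι ι ℂ) (ρ : Type) [Fintype ρ] [DecidableEq ρ] : Prop :=
  ∃ (A : X → Matrix ι ρ ℂ) (B : X → Matrix ρ ι ℂ), Continuous A ∧ Continuous B ∧
    (∀ x, B x * A x = 1) ∧ ∀ x, A x * B x = e x

namespace Free

variable {e : X → Matrix ι ι ℂ}

theorem conj (F : Free e ρ) {g : X → Matrix κ ι ℂ} {g' : X → Matrix ι κ ℂ} (hg : Continuous g)
    (hg' : Continuous g') (h : ∀ x, g' x * g x * e x = e x) {e' : X → Matrix κ κ ℂ}
    (he' : ∀ x, g x * e x * g' x = e' x) : Free e' ρ := by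
  obtain ⟨A, B, hA, hB, hBA, hAB⟩ := F
  refine ⟨fun x => g x * A x, fun x => B x * g' x, hg.matrix_mul hA, hB.matrix_mul hg',
    fun x => ?_, fun x => ?_⟩
  · have h1 : A x = e x * A x := by rw [← hAB, Matrix.mul_assoc, hBA, Matrix.mul_one]
    calc B x * g' x * (g x * A x) = B x * (g' x * g x * e x) * A x := by
          conv_lhs => rw [h1]
          simp only [Matrix.mul_assoc]
      _ = B x * (e x * A x) := by rw [h, Matrix.mul_assoc]
      _ = 1 := by rw [← h1, hBA]
  · rw [← he', ← hAB]; simp only [Matrix.mul_assoc]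

theorem reindex (F : Free e ρ) (f : ρ ≃ τ) : Free e τ := by
  obtain ⟨A, B, hA, hB, hBA, hAB⟩ := F
  refine ⟨fun x => (A x).submatrix id f.symm, fun x => (B x).submatrix f.symm id,
    hA.matrix_submatrix _ _, hB.matrix_submatrix _ _, fun x => ?_, fun x => ?_⟩
  · rw [← submatrix_mul _ _ _ _ _ Function.bijective_id, hBA, submatrix_one_equiv]
  · rw [← submatrix_mul _ _ _ _ _ f.symm.bijective, hAB, submatrix_id_id]

theorem submatrix (F : Free e ρ) (f : κ ≃ ι) : Free (fun x => (e x).submatrix f f) ρ := by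
  obtain ⟨A, B, hA, hB, hBA, hAB⟩ := F
  refine ⟨fun x => (A x).submatrix f id, fun x => (B x).submatrix id f,
    hA.matrix_submatrix _ _, hB.matrix_submatrix _ _, fun x => ?_, fun x => ?_⟩
  · rw [← submatrix_mul _ _ _ _ _ f.bijective, hBA, submatrix_id_id]
  · rw [← submatrix_mul _ _ _ _ _ Function.bijective_id, hAB]

theorem stab (F : Free e ρ) : Free (fun x => stab κ (e x)) (ρ ⊕ κ) := by
  obtain ⟨A, B, hA, hB, hBA, hAB⟩ := F
  refine ⟨fun x => fromBlocks (A x) 0 0 1, fun x => fromBlocks (B x) 0 0 1,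
    hA.matrix_fromBlocks continuous_const continuous_const continuous_const,
    hB.matrix_fromBlocks continuous_const continuous_const continuous_const, fun x => ?_,
    fun x => ?_⟩
  · simp [fromBlocks_multiply, hBA]
  · simp [fromBlocks_multiply, hAB]

end Free

theorem exists_factorization {p : Matrix ι ι ℂ} (hp : p * p = p) :
    ∃ (r : ℕ) (A : Matrix ι (Fin r) ℂ) (B : Matrix (Fin r) ι ℂ), B * A = 1 ∧ A * B = p := by
  let f := toLin' p
  have hff : f ∘ₗ f = f := by rw [← toLin'_mul, hp]
  let b := Module.finBasis ℂ (LinearMap.range f)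
  let c := Pi.basisFun ℂ ι
  refine ⟨_, LinearMap.toMatrix b c (LinearMap.range f).subtype,
    LinearMap.toMatrix c b f.rangeRestrict, ?_, ?_⟩
  · rw [← LinearMap.toMatrix_comp b c b]
    have : f.rangeRestrict ∘ₗ (LinearMap.range f).subtype = LinearMap.id := by
      refine LinearMap.ext ?_
      rintro ⟨_, x, rfl⟩
      exact Subtype.ext (LinearMap.congr_fun hff x)
    rw [this, LinearMap.toMatrix_id]
  · have : (LinearMap.range f).subtype ∘ₗ f.rangeRestrict = f := LinearMap.ext fun _ => rfl
    rw [← LinearMap.toMatrix_comp c b c, this]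
    exact LinearMap.toMatrix'_toLin' p

/-- A stable conjugation to a constant idempotent trivializes the image after adding a trivial
bundle. -/
theorem Free.of_stable_conj {e : X → Matrix ι ι ℂ} {p : Matrix ι ι ℂ} {q : Matrix κ κ ℂ}
    (hq : q * q = q) {g : X → Matrix (ι ⊕ κ) (ι ⊕ κ) ℂ}
    (hg : Continuous g) (hgu : ∀ x, IsUnit (g x))
    (h : ∀ x, fromBlocks (e x) 0 0 q * g x = g x * fromBlocks p 0 0 q)
    (F : Free (fun _ : X => p) ρ) : Free (fun x => AlmostContact.stab κ (e x)) (ρ ⊕ κ) := by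
  have hgi := continuous_matrix_inv hg hgu
  have hgg : ∀ x, (g x)⁻¹ * g x = 1 := fun x => inv_mul_of_isUnit (hgu x)
  have hgg' : ∀ x, g x * (g x)⁻¹ = 1 := fun x => mul_inv_of_isUnit (hgu x)
  have hs := isUnit_straighten hq
  have hss := inv_mul_of_isUnit hs
  have hss' := mul_inv_of_isUnit hs
  set s := straighten q
  have hsc : s * fromBlocks q 0 0 (1 - q) = fromBlocks 1 0 0 0 * s := straighten_conj_idem hq
  -- the inclusion of the first summand
  let J : Matrix κ (κ ⊕ κ) ℂ := fromCols 1 0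
  let Jt : Matrix (κ ⊕ κ) κ ℂ := fromRows 1 0
  have hJ : J * Jt = 1 := by simp [J, Jt, fromCols_mul_fromRows]
  have hJ' : Jt * J = fromBlocks 1 0 0 0 := by
    ext i j; rcases i with i | i <;> rcases j with j | j <;>
      simp [J, Jt, Matrix.mul_apply, Matrix.one_apply]
  have key : ∀ E : X → Matrix ι ι ℂ, Free (fun x => AlmostContact.stab κ (E x)) (ρ ⊕ κ) ↔
      Free (fun x => fromBlocks (E x) 0 0 (fromBlocks q 0 0 (1 - q))) (ρ ⊕ κ) := by
    intro E
    have hsJ : s⁻¹ * (Jt * J) * s = fromBlocks q 0 0 (1 - q) := by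
      rw [hJ', Matrix.mul_assoc, ← hsc, ← Matrix.mul_assoc, hss, Matrix.one_mul]
    constructor
    · intro F
      refine F.conj (g := fun _ => fromBlocks 1 0 0 (s⁻¹ * Jt)) (g' := fun _ =>
        fromBlocks 1 0 0 (J * s)) continuous_const continuous_const (fun x => ?_) fun x => ?_
      · have : J * s * (s⁻¹ * Jt) = 1 := by
          rw [Matrix.mul_assoc, ← Matrix.mul_assoc s, hss', Matrix.one_mul, hJ]
        simp [fromBlocks_multiply, this]
      · have : s⁻¹ * Jt * (J * s) = fromBlocks q 0 0 (1 - q) := by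
          rw [← hsJ]; simp only [Matrix.mul_assoc]
        simp [fromBlocks_multiply, this]
    · intro F
      refine F.conj (g := fun _ => fromBlocks 1 0 0 (J * s)) (g' := fun _ =>
        fromBlocks 1 0 0 (s⁻¹ * Jt)) continuous_const continuous_const (fun x => ?_) fun x => ?_
      · have h1 : s⁻¹ * Jt * (J * s) = fromBlocks q 0 0 (1 - q) := by
          rw [← hsJ]; simp only [Matrix.mul_assoc]
        have h2 : q * q = q := hq
        simp [fromBlocks_multiply, h1, h2, sub_mul, mul_sub]
      · have h1 : J * s * fromBlocks q 0 0 (1 - q) * (s⁻¹ * Jt) = 1 := by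
          calc _ = J * (s * fromBlocks q 0 0 (1 - q)) * s⁻¹ * Jt := by
                simp only [Matrix.mul_assoc]
            _ = (J * Jt) * (J * (s * s⁻¹) * Jt) := by
                rw [hsc, ← hJ']; simp only [Matrix.mul_assoc]
            _ = 1 := by rw [hss', Matrix.mul_one, hJ, Matrix.one_mul]
        simp only [fromBlocks_multiply, Matrix.mul_zero, Matrix.zero_mul, Matrix.mul_one,
          Matrix.one_mul, add_zero, zero_add, h1]
  rw [key]
  have F1 := ((key (fun _ => p)).1 F.stab)
  let f := Equiv.sumAssoc ι κ κ
  let G : X → Matrix (ι ⊕ (κ ⊕ κ)) (ι ⊕ (κ ⊕ κ)) ℂ := fun x =>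
    (AlmostContact.stab κ (g x)).submatrix f.symm f.symm
  let G' : X → Matrix (ι ⊕ (κ ⊕ κ)) (ι ⊕ (κ ⊕ κ)) ℂ := fun x =>
    (AlmostContact.stab κ (g x)⁻¹).submatrix f.symm f.symm
  have hre : ∀ A : Matrix ι ι ℂ, fromBlocks A 0 0 (fromBlocks q 0 0 (1 - q)) =
      (fromBlocks (fromBlocks A 0 0 q) 0 0 (1 - q)).submatrix f.symm f.symm := by
    intro A
    ext i j
    rcases i with i | i | i <;> rcases j with j | j | j <;> rfl
  refine F1.conj (g := G) (g' := G') ?_ ?_ (fun x => ?_) fun x => ?_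
  · exact (hg.matrix_fromBlocks continuous_const continuous_const
      continuous_const).matrix_submatrix _ _
  · exact (hgi.matrix_fromBlocks continuous_const continuous_const
      continuous_const).matrix_submatrix _ _
  · have : G' x * G x = 1 := by
      simp only [G, G']
      rw [submatrix_mul_equiv, ← stab_mul, hgg]
      simp [AlmostContact.stab]
    rw [this, Matrix.one_mul]
  · simp only [G, G', hre]
    rw [submatrix_mul_equiv, submatrix_mul_equiv]
    congr 1
    simp only [fromBlocks_multiply, Matrix.mul_zero, Matrix.zero_mul, Matrix.mul_one,
      Matrix.one_mul, add_zero, zero_add]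
    rw [← h, Matrix.mul_assoc, hgg', Matrix.mul_one]

section Cancel

variable {E : Type} [NormedAddCommGroup E] [InnerProductSpace ℝ E] [FiniteDimensional ℝ E]

theorem Free.cancel_one (hdim : Module.finrank ℝ E < 2 * Fintype.card ρ + 1)
    {e : Metric.sphere (0 : E) 1 → Matrix ι ι ℂ}
    (F : Free (fun x => AlmostContact.stab (Fin 1) (e x)) (ρ ⊕ Fin 1)) : Free e ρ := by
  obtain ⟨A, B, hA, hB, hBA, hAB⟩ := F
  let w : ι ⊕ Fin 1 → ℂ := Pi.single (Sum.inr 0) 1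
  let w' : ρ ⊕ Fin 1 → ℂ := Pi.single (Sum.inr 0) 1
  have hw : w ≠ 0 := by simp [w]
  have hw' : w' ≠ 0 := by simp [w']
  have hew : ∀ x, AlmostContact.stab (Fin 1) (e x) *ᵥ w = w := by
    intro x
    ext i
    rcases i with i | i
    · simp [w]
    · have : i = 0 := Subsingleton.elim _ _
      simp [w, this]
  have hABw : ∀ x, A x *ᵥ (B x *ᵥ w) = w := fun x => by rw [mulVec_mulVec, hAB, hew]
  obtain ⟨a, ha, hau, has⟩ := exists_completion (E := E) (ι := ρ ⊕ Fin 1)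
    (s := fun x => B x *ᵥ w) (by simp only [Fintype.card_sum, Fintype.card_fin]; omega)
    (hB.matrix_mulVec continuous_const)
    (fun x h => hw (by rw [← hABw x, h, mulVec_zero])) hw'
  have hai := continuous_matrix_inv ha hau
  have h1 : ∀ x, a x * (a x)⁻¹ = 1 := fun x => mul_inv_of_isUnit (hau x)
  have h2 : ∀ x, (a x)⁻¹ * a x = 1 := fun x => inv_mul_of_isUnit (hau x)
  let A' := fun x => A x * a x
  let B' := fun x => (a x)⁻¹ * B x
  have hA' : Continuous A' := hA.matrix_mul ha
  have hB' : Continuous B' := hai.matrix_mul hB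
  have hBA' : ∀ x, B' x * A' x = 1 := fun x => by
    simp only [A', B']
    rw [Matrix.mul_assoc, ← Matrix.mul_assoc (B x), hBA, Matrix.one_mul, h2]
  have hAB' : ∀ x, A' x * B' x = AlmostContact.stab (Fin 1) (e x) := fun x => by
    simp only [A', B']
    rw [Matrix.mul_assoc, ← Matrix.mul_assoc (a x), h1, Matrix.one_mul, hAB]
  have hAw : ∀ x, A' x *ᵥ w' = w := fun x => by
    simp only [A']; rw [← mulVec_mulVec, has, hABw]
  have hBw : ∀ x, B' x *ᵥ w = w' := fun x => by
    rw [← hAw x, mulVec_mulVec, hBA', one_mulVec]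
  have hA12 : ∀ x, (A' x).toBlocks₁₂ = 0 := by
    intro x
    ext i j
    have := congrFun (hAw x) (Sum.inl i)
    have hj : j = 0 := Subsingleton.elim _ _
    simpa [w, w', hj, toBlocks₁₂] using this
  have hB12 : ∀ x, (B' x).toBlocks₁₂ = 0 := by
    intro x
    ext i j
    have := congrFun (hBw x) (Sum.inl i)
    have hj : j = 0 := Subsingleton.elim _ _
    simpa [w, w', hj, toBlocks₁₂] using this
  have hAf : ∀ x, A' x = fromBlocks (A' x).toBlocks₁₁ 0 (A' x).toBlocks₂₁ (A' x).toBlocks₂₂ :=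
    fun x => by rw [← hA12 x, fromBlocks_toBlocks]
  have hBf : ∀ x, B' x = fromBlocks (B' x).toBlocks₁₁ 0 (B' x).toBlocks₂₁ (B' x).toBlocks₂₂ :=
    fun x => by rw [← hB12 x, fromBlocks_toBlocks]
  refine ⟨fun x => (A' x).toBlocks₁₁, fun x => (B' x).toBlocks₁₁,
    hA'.matrix_submatrix Sum.inl Sum.inl, hB'.matrix_submatrix Sum.inl Sum.inl,
    fun x => ?_, fun x => ?_⟩
  · have := hBA' x
    rw [hAf, hBf, fromBlocks_multiply, ← fromBlocks_one, fromBlocks_inj] at this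
    simpa using this.1
  · have := hAB' x
    rw [hAf, hBf, fromBlocks_multiply, fromBlocks_inj] at this
    simpa using this.1

theorem Free.cancel_fin {e : Metric.sphere (0 : E) 1 → Matrix ι ι ℂ} (k : ℕ)
    (hdim : Module.finrank ℝ E < 2 * Fintype.card ρ + 1)
    (F : Free (fun x => AlmostContact.stab (Fin k) (e x)) (ρ ⊕ Fin k)) : Free e ρ := by
  induction k with
  | zero =>
    have := (F.submatrix (Equiv.sumEmpty ι (Fin 0)).symm).reindex (Equiv.sumEmpty ρ (Fin 0))
    exact this
  | succ k ih =>
    refine ih (Free.cancel_one (by rw [Fintype.card_sum]; omega) ?_)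
    have h1 := (F.submatrix ((Equiv.sumAssoc ι (Fin k) (Fin 1)).trans
      (Equiv.sumCongr (Equiv.refl ι) finSumFinEquiv))).reindex
      ((Equiv.sumAssoc ρ (Fin k) (Fin 1)).trans
        (Equiv.sumCongr (Equiv.refl ρ) finSumFinEquiv)).symm
    have h2 : ∀ A : Matrix ι ι ℂ, (AlmostContact.stab (Fin (k + 1)) A).submatrix
        ((Equiv.sumAssoc ι (Fin k) (Fin 1)).trans
          (Equiv.sumCongr (Equiv.refl ι) finSumFinEquiv))
        ((Equiv.sumAssoc ι (Fin k) (Fin 1)).trans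
          (Equiv.sumCongr (Equiv.refl ι) finSumFinEquiv))
        = AlmostContact.stab (Fin 1) (AlmostContact.stab (Fin k) A) := by
      intro A
      ext i j
      rcases i with (i | i) | i <;> rcases j with (j | j) | j <;>
        simp [Matrix.one_apply, Fin.ext_iff] <;> omega
    simpa only [h2] using h1

theorem Free.cancel {e : Metric.sphere (0 : E) 1 → Matrix ι ι ℂ}
    (hdim : Module.finrank ℝ E < 2 * Fintype.card ρ + 1)
    (F : Free (fun x => AlmostContact.stab κ (e x)) (ρ ⊕ κ)) : Free e ρ := by
  let f := Fintype.equivFin κ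
  refine Free.cancel_fin (Fintype.card κ) hdim ?_
  have h := (F.submatrix (Equiv.sumCongr (Equiv.refl ι) f.symm)).reindex
    (Equiv.sumCongr (Equiv.refl ρ) f)
  have h2 : ∀ A : Matrix ι ι ℂ, (AlmostContact.stab κ A).submatrix
      (Equiv.sumCongr (Equiv.refl ι) f.symm) (Equiv.sumCongr (Equiv.refl ι) f.symm)
      = AlmostContact.stab (Fin (Fintype.card κ)) A := by
    intro A
    ext i j
    rcases i with i | i <;> rcases j with j | j <;> simp [Matrix.one_apply]
  simpa only [h2] using h

end Cancel

end

section

variable {X Z : Type} [TopologicalSpace X] [TopologicalSpace Z]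
variable {ι κ : Type} [Fintype ι] [DecidableEq ι] [Fintype κ] [DecidableEq κ]
variable {ρ : Type} [Fintype ρ] [DecidableEq ρ]

section Sqrt

open scoped Matrix.Norms.L2Operator ComplexOrder MatrixOrder

theorem exists_continuous_sqrt {M : X → Matrix ρ ρ ℂ} (hM : Continuous M)
    (hp : ∀ x, (M x).PosSemidef) :
    ∃ S : X → Matrix ρ ρ ℂ, Continuous S ∧ (∀ x, (S x)ᴴ = S x) ∧ ∀ x, S x * S x = M x := by
  have hn : ∀ x, 0 ≤ M x := fun x => (hp x).nonneg
  refine ⟨fun x => CFC.sqrt (M x), CFC.continuousOn_sqrt.comp_continuous hM hn, fun x => ?_,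
    fun x => CFC.sqrt_mul_sqrt_self _ (hn x)⟩
  exact (CFC.sqrt_nonneg (M x)).posSemidef.isHermitian

end Sqrt

open scoped ComplexOrder in
theorem Free.exists_isometry {e : X → Matrix ι ι ℂ} (F : Free e ρ) (he : ∀ x, (e x)ᴴ = e x) :
    ∃ A : X → Matrix ι ρ ℂ, Continuous A ∧ (∀ x, (A x)ᴴ * A x = 1) ∧
      ∀ x, A x * (A x)ᴴ = e x := by
  obtain ⟨A, B, hA, hB, hBA, hAB⟩ := F
  obtain ⟨S, hS, hSh, hSS⟩ := exists_continuous_sqrt (hA.matrix_conjTranspose.matrix_mul hA)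
    fun x => posSemidef_conjTranspose_mul_self (A x)
  have heA : ∀ x, e x * A x = A x := fun x => by
    rw [← hAB, Matrix.mul_assoc, hBA, Matrix.mul_one]
  have hu : ∀ x, IsUnit ((A x)ᴴ * A x) := by
    intro x
    refine IsUnit.of_mul_eq_one (B x * (B x)ᴴ) ?_
    calc (A x)ᴴ * A x * (B x * (B x)ᴴ) = (A x)ᴴ * (A x * B x) * (B x)ᴴ := by
          simp only [Matrix.mul_assoc]
      _ = (B x * (e x * A x))ᴴ := by
          rw [hAB, conjTranspose_mul, conjTranspose_mul, he]
      _ = 1 := by rw [heA, hBA, conjTranspose_one]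
  have hSu : ∀ x, IsUnit (S x) := fun x => by
    have := hu x
    rw [← hSS] at this
    exact isUnit_of_mul_isUnit_left this
  have h1 : ∀ x, S x * (S x)⁻¹ = 1 := fun x => mul_inv_of_isUnit (hSu x)
  have h2 : ∀ x, (S x)⁻¹ * S x = 1 := fun x => inv_mul_of_isUnit (hSu x)
  have h3 : ∀ x, (A x * (S x)⁻¹)ᴴ * (A x * (S x)⁻¹) = 1 := fun x => by
    rw [conjTranspose_mul, conjTranspose_nonsing_inv, hSh]
    calc (S x)⁻¹ * (A x)ᴴ * (A x * (S x)⁻¹) = (S x)⁻¹ * ((A x)ᴴ * A x) * (S x)⁻¹ := by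
          simp only [Matrix.mul_assoc]
      _ = ((S x)⁻¹ * S x) * (S x * (S x)⁻¹) := by rw [← hSS]; simp only [Matrix.mul_assoc]
      _ = 1 := by rw [h1, h2, Matrix.mul_one]
  refine ⟨fun x => A x * (S x)⁻¹, hA.matrix_mul (continuous_matrix_inv hS hSu), h3, fun x => ?_⟩
  have h4 : A x * (S x)⁻¹ * (S x * B x) = e x := by
    rw [Matrix.mul_assoc, ← Matrix.mul_assoc _ (S x), h2, Matrix.one_mul, hAB]
  have h5 : (A x * (S x)⁻¹)ᴴ * e x = (A x * (S x)⁻¹)ᴴ := by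
    rw [← he, ← conjTranspose_mul, ← Matrix.mul_assoc, heA]
  have h6 : (A x * (S x)⁻¹)ᴴ = S x * B x := by
    rw [← h5, ← h4, ← Matrix.mul_assoc, h3, Matrix.one_mul]
  rw [h6, h4]

end

section

/-- Pointwise application of a continuous family of invertible self-maps is a self-homeomorphism
of the space of continuous maps. -/
def mapHomeomorph {X Y : Type} [TopologicalSpace X] [LocallyCompactSpace X] [TopologicalSpace Y]
    (T T' : X → Y → Y) (hT : Continuous fun p : X × Y => T p.1 p.2)
    (hT' : Continuous fun p : X × Y => T' p.1 p.2) (h : ∀ x y, T' x (T x y) = y)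
    (h' : ∀ x y, T x (T' x y) = y) : C(X, Y) ≃ₜ C(X, Y) where
  toFun f := ⟨fun x => T x (f x), hT.comp (continuous_id.prodMk f.continuous)⟩
  invFun f := ⟨fun x => T' x (f x), hT'.comp (continuous_id.prodMk f.continuous)⟩
  left_inv f := ContinuousMap.ext fun x => h x (f x)
  right_inv f := ContinuousMap.ext fun x => h' x (f x)
  continuous_toFun := ContinuousMap.continuous_of_continuous_uncurry _
    (hT.comp (continuous_snd.prodMk continuous_eval))
  continuous_invFun := ContinuousMap.continuous_of_continuous_uncurry _
    (hT'.comp (continuous_snd.prodMk continuous_eval))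

theorem nonempty_homeomorph_pathComponent {X Y : Type} [TopologicalSpace X] [TopologicalSpace Y]
    (H : X ≃ₜ Y) (x : X) : Nonempty (pathComponent x ≃ₜ pathComponent (H x)) := by
  refine ⟨H.subtype fun y => ⟨fun h => ?_, fun h => ?_⟩⟩
  · exact Joined.map h H.continuous
  · have := Joined.map h H.symm.continuous
    rwa [H.symm_apply_apply, H.symm_apply_apply] at this

section Gamma

variable {n : ℕ}

theorem conj_mem_Gamma {h J : Matrix (Fin n ⊕ Fin n) (Fin n ⊕ Fin n) ℝ} (hh : hᵀ * h = 1)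
    (hh' : h * hᵀ = 1) (hJ : J ∈ Gamma n) : h * J * hᵀ ∈ Gamma n := by
  constructor
  · calc (h * J * hᵀ)ᵀ * (h * J * hᵀ) = h * (Jᵀ * (hᵀ * h) * J) * hᵀ := by
          simp only [transpose_mul, transpose_transpose, Matrix.mul_assoc]
      _ = 1 := by rw [hh, Matrix.mul_one, hJ.1, Matrix.mul_one, hh']
  · calc h * J * hᵀ * (h * J * hᵀ) = h * (J * (hᵀ * h) * J) * hᵀ := by
          simp only [Matrix.mul_assoc]
      _ = -1 := by rw [hh, Matrix.mul_one, hJ.2, Matrix.mul_neg, Matrix.mul_one, Matrix.neg_mul,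
                    hh']

/-- Conjugation by an orthogonal matrix maps `GammaPlus` to itself as soon as it maps one point of
`GammaPlus` into `GammaPlus`. -/
theorem conj_mem_GammaPlus {h : Matrix (Fin n ⊕ Fin n) (Fin n ⊕ Fin n) ℝ} (hh : hᵀ * h = 1)
    (hh' : h * hᵀ = 1) {J K L : Gamma n} (hJ : J ∈ GammaPlus n) (hK : K ∈ GammaPlus n)
    (hL : L ∈ GammaPlus n) (hKL : h * K.1 * hᵀ = L.1) :
    (⟨h * J.1 * hᵀ, conj_mem_Gamma hh hh' J.2⟩ : Gamma n) ∈ GammaPlus n := by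
  let c : Gamma n → Gamma n := fun J => ⟨h * J.1 * hᵀ, conj_mem_Gamma hh hh' J.2⟩
  have hc : Continuous c := Continuous.subtype_mk
    ((continuous_const.matrix_mul continuous_subtype_val).matrix_mul continuous_const) _
  have hcK : c K = L := Subtype.ext hKL
  have hKJ : Joined K J := (show Joined _ K from hK).symm.trans hJ
  have := hKJ.map hc
  rw [hcK] at this
  exact (show Joined _ L from hL).trans this

/-- A continuous family of orthogonal matrices conjugating the standard structure into `f` gives
a self-homeomorphism of the mapping space taking the constant map at the base point to `f`. -/
theorem exists_homeomorph_const {X : Type} [TopologicalSpace X] [LocallyCompactSpace X]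
    (f : C(X, GammaPlus n)) {h : X → Matrix (Fin n ⊕ Fin n) (Fin n ⊕ Fin n) ℝ}
    (hc : Continuous h) (hh : ∀ x, (h x)ᵀ * h x = 1)
    (hf : ∀ x, (f x).1.1 * h x = h x * J0 n) :
    ∃ H : C(X, GammaPlus n) ≃ₜ C(X, GammaPlus n), H (ContinuousMap.const X (J0plus n)) = f := by
  have hh' : ∀ x, h x * (h x)ᵀ = 1 := fun x => mul_eq_one_comm.1 (hh x)
  have hJ : ∀ x, h x * J0 n * (h x)ᵀ = (f x).1.1 := fun x => by
    rw [← hf, Matrix.mul_assoc, hh', Matrix.mul_one]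
  have hht : ∀ x, ((h x)ᵀ)ᵀ * (h x)ᵀ = 1 := fun x => by rw [transpose_transpose, hh']
  have hht' : ∀ x, (h x)ᵀ * ((h x)ᵀ)ᵀ = 1 := fun x => by rw [transpose_transpose, hh]
  have hJ' : ∀ x, (h x)ᵀ * (f x).1.1 * ((h x)ᵀ)ᵀ = J0 n := fun x => by
    rw [transpose_transpose, Matrix.mul_assoc, hf, ← Matrix.mul_assoc, hh, Matrix.one_mul]
  have hct : Continuous fun x => (h x)ᵀ := hc.matrix_transpose
  let T : X → GammaPlus n → GammaPlus n := fun x J =>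
    ⟨_, conj_mem_GammaPlus (hh x) (hh' x) J.2 (J0plus n).2 (f x).2 (hJ x)⟩
  let T' : X → GammaPlus n → GammaPlus n := fun x J =>
    ⟨_, conj_mem_GammaPlus (hht x) (hht' x) J.2 (f x).2 (J0plus n).2 (hJ' x)⟩
  have hval : Continuous fun p : X × GammaPlus n => p.2.1.1 :=
    continuous_subtype_val.comp (continuous_subtype_val.comp continuous_snd)
  have hT : Continuous fun p : X × GammaPlus n => T p.1 p.2 :=
    Continuous.subtype_mk (Continuous.subtype_mk (((hc.comp continuous_fst).matrix_mul
      hval).matrix_mul (hct.comp continuous_fst)) _) _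
  have hT' : Continuous fun p : X × GammaPlus n => T' p.1 p.2 :=
    Continuous.subtype_mk (Continuous.subtype_mk (((hct.comp continuous_fst).matrix_mul
      hval).matrix_mul (hct.matrix_transpose.comp continuous_fst)) _) _
  refine ⟨mapHomeomorph T T' hT hT' (fun x J => Subtype.ext (Subtype.ext ?_))
    fun x J => Subtype.ext (Subtype.ext ?_), ContinuousMap.ext fun x =>
      Subtype.ext (Subtype.ext (hJ x))⟩
  · change (h x)ᵀ * (h x * J.1.1 * (h x)ᵀ) * ((h x)ᵀ)ᵀ = J.1.1
    calc _ = ((h x)ᵀ * h x) * J.1.1 * ((h x)ᵀ * ((h x)ᵀ)ᵀ) := by simp only [Matrix.mul_assoc]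
      _ = J.1.1 := by rw [hh, hht', Matrix.one_mul, Matrix.mul_one]
  · change h x * ((h x)ᵀ * J.1.1 * ((h x)ᵀ)ᵀ) * (h x)ᵀ = J.1.1
    calc _ = (h x * (h x)ᵀ) * J.1.1 * (((h x)ᵀ)ᵀ * (h x)ᵀ) := by simp only [Matrix.mul_assoc]
      _ = J.1.1 := by rw [hh', hht, Matrix.one_mul, Matrix.mul_one]

theorem transpose_of_mem_Gamma {J : Matrix (Fin n ⊕ Fin n) (Fin n ⊕ Fin n) ℝ}
    (hJ : J ∈ Gamma n) : Jᵀ = -J := by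
  have h : J * -J = 1 := by rw [Matrix.mul_neg, hJ.2, neg_neg]
  rw [← Matrix.mul_one Jᵀ, ← h, ← Matrix.mul_assoc, hJ.1, Matrix.one_mul]

/-- The projection onto the `i`-eigenspace of a complex structure. -/
noncomputable def eigenProj (J : Matrix (Fin n ⊕ Fin n) (Fin n ⊕ Fin n) ℝ) :
    Matrix (Fin n ⊕ Fin n) (Fin n ⊕ Fin n) ℂ :=
  (1 / 2 : ℂ) • (1 - Complex.I • J.map Complex.ofReal)

theorem continuous_eigenProj :
    Continuous (eigenProj : Matrix (Fin n ⊕ Fin n) (Fin n ⊕ Fin n) ℝ → _) := by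
  have h : Continuous fun J : Matrix (Fin n ⊕ Fin n) (Fin n ⊕ Fin n) ℝ => J.map Complex.ofReal :=
    continuous_id.matrix_map Complex.continuous_ofReal
  unfold eigenProj
  fun_prop

theorem mul_eigenProj {J : Matrix (Fin n ⊕ Fin n) (Fin n ⊕ Fin n) ℝ} (hJ : J ∈ Gamma n) :
    J.map Complex.ofReal * eigenProj J = Complex.I • eigenProj J := by
  have h : J.map Complex.ofReal * J.map Complex.ofReal = -1 := by
    have := (Matrix.map_mul (f := Complex.ofRealHom) (L := J) (M := J)).symm
    rw [hJ.2] at this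
    refine this.trans ?_
    ext i j
    by_cases hij : i = j <;> simp [hij]
  rw [eigenProj, Matrix.mul_smul, smul_comm, mul_sub, Matrix.mul_one, Matrix.mul_smul, h]
  congr 1
  rw [smul_sub, smul_smul, Complex.I_mul_I]
  simp only [smul_neg, neg_smul, one_smul, sub_neg_eq_add]
  exact add_comm _ _

theorem eigenProj_mul_self {J : Matrix (Fin n ⊕ Fin n) (Fin n ⊕ Fin n) ℝ} (hJ : J ∈ Gamma n) :
    eigenProj J * eigenProj J = eigenProj J := by
  conv_lhs => rw [eigenProj]
  rw [smul_mul, sub_mul, Matrix.one_mul, smul_mul, ← eigenProj, mul_eigenProj hJ, smul_smul,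
    Complex.I_mul_I, neg_smul, one_smul, sub_neg_eq_add, ← two_smul ℂ, smul_smul]
  norm_num

theorem eigenProj_conjTranspose {J : Matrix (Fin n ⊕ Fin n) (Fin n ⊕ Fin n) ℝ}
    (hJ : J ∈ Gamma n) : (eigenProj J)ᴴ = eigenProj J := by
  have h : (J.map Complex.ofReal)ᴴ = -J.map Complex.ofReal := by
    ext i j
    have := congrFun (congrFun (transpose_of_mem_Gamma hJ) i) j
    simp only [transpose_apply, Matrix.neg_apply] at this
    simp [this]
  rw [eigenProj, conjTranspose_smul, conjTranspose_sub, conjTranspose_one, conjTranspose_smul, h]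
  simp

theorem trace_eigenProj {J : Matrix (Fin n ⊕ Fin n) (Fin n ⊕ Fin n) ℝ}
    (hJ : J ∈ Gamma n) : (eigenProj J).trace = n := by
  have h : J.trace = 0 := by
    have := congrArg Matrix.trace (transpose_of_mem_Gamma hJ)
    rw [trace_transpose, trace_neg] at this
    linarith
  have h' : (J.map Complex.ofReal).trace = 0 := by
    have := congrArg Complex.ofReal h
    simpa [Matrix.trace] using this
  rw [eigenProj, trace_smul, trace_sub, trace_smul, h', trace_one]
  simp only [Fintype.card_sum, Fintype.card_fin, smul_eq_mul]
  push_cast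
  ring

/-- A unitary frame of the `i`-eigenbundle yields an orthogonal frame adapted to the complex
structure. -/
theorem exists_adapted_frame {J : Matrix (Fin n ⊕ Fin n) (Fin n ⊕ Fin n) ℝ} (hJ : J ∈ Gamma n)
    {A : Matrix (Fin n ⊕ Fin n) (Fin n) ℂ} (hA : A * Aᴴ = eigenProj J) (hA' : Aᴴ * A = 1) :
    let h := √2 • fromCols (A.map Complex.re) (-A.map Complex.im)
    hᵀ * h = 1 ∧ J * h = h * J0 n := by
  intro h
  have hJA : J.map Complex.ofReal * A = Complex.I • A := by
    have : A = eigenProj J * A := by rw [← hA, Matrix.mul_assoc, hA', Matrix.mul_one]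
    rw [this, ← Matrix.mul_assoc, mul_eigenProj hJ, smul_mul]
  have hre : J * A.map Complex.re = -A.map Complex.im := by
    ext i j
    have := congrArg Complex.re (congrFun (congrFun hJA i) j)
    simpa [Matrix.mul_apply] using this
  have him : J * A.map Complex.im = A.map Complex.re := by
    ext i j
    have := congrArg Complex.im (congrFun (congrFun hJA i) j)
    simpa [Matrix.mul_apply] using this
  constructor
  · rw [mul_eq_one_comm]
    have h1 : A.map Complex.re * (A.map Complex.re)ᵀ + A.map Complex.im * (A.map Complex.im)ᵀ =
        (1 / 2 : ℝ) • (1 : Matrix (Fin n ⊕ Fin n) (Fin n ⊕ Fin n) ℝ) := by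
      ext i j
      have := congrArg Complex.re (congrFun (congrFun hA i) j)
      by_cases hij : i = j <;>
        simpa [Matrix.mul_apply, eigenProj, Finset.sum_add_distrib, Matrix.one_apply, hij]
          using this
    simp only [h]
    rw [transpose_smul, smul_mul, Matrix.mul_smul, smul_smul, Real.mul_self_sqrt two_pos.le,
      transpose_fromCols, fromCols_mul_fromRows, transpose_neg, Matrix.neg_mul, Matrix.mul_neg,
      neg_neg, h1, smul_smul]
    norm_num
  · simp only [h, J0]
    rw [Matrix.mul_smul, smul_mul, mul_fromCols, fromCols_mul_fromBlocks, Matrix.mul_neg, hre, him]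
    simp

end Gamma

instance (m : ℕ) : CompactSpace (Sph m) :=
  inferInstanceAs (CompactSpace (Metric.sphere (0 : EuclideanSpace ℝ (Fin (m + 1))) 1))

/-- The `i`-eigenbundle of an almost contact structure on an odd sphere is trivial. -/
theorem free_eigenProj (n : ℕ) (f : C(Sph (2 * n + 1), GammaPlus (n + 1))) :
    Free (fun x => eigenProj (f x).1.1) (Fin (n + 1)) := by
  obtain ⟨P, hP⟩ := kZero_sphere n
  have he : ∀ x, eigenProj (f x).1.1 * eigenProj (f x).1.1 = eigenProj (f x).1.1 :=
    fun x => eigenProj_mul_self (f x).1.2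
  have hc : Continuous fun x => eigenProj (f x).1.1 := continuous_eigenProj.comp
    (continuous_subtype_val.comp (continuous_subtype_val.comp f.continuous))
  obtain ⟨κ, _, _, q, g, hq, hg, hgu, -, h⟩ := hP (Fin (n + 1) ⊕ Fin (n + 1))
    (fun x => eigenProj (f x).1.1) (eigenProj (f P).1.1) hc he (he P) (by
      rintro x rfl
      rfl)
  obtain ⟨r, A, B, hBA, hAB⟩ := exists_factorization (he P)
  have hr : r = n + 1 := by
    have h1 := trace_eigenProj (f P).1.2
    rw [← hAB, trace_mul_comm, hBA, trace_one, Fintype.card_fin] at h1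
    exact_mod_cast h1
  subst hr
  have F := Free.of_stable_conj hq hg hgu h
    ⟨fun _ => A, fun _ => B, continuous_const, continuous_const, fun _ => hBA, fun _ => hAB⟩
  exact Free.cancel (E := EuclideanSpace ℝ (Fin (2 * n + 1 + 1))) (by simp; omega) F

theorem exists_homeomorph (n : ℕ) (f : C(Sph (2 * n + 1), GammaPlus (n + 1))) :
    ∃ H : C(Sph (2 * n + 1), GammaPlus (n + 1)) ≃ₜ C(Sph (2 * n + 1), GammaPlus (n + 1)),
      H (ContinuousMap.const _ (J0plus (n + 1))) = f := by
  obtain ⟨A, hA, hA1, hA2⟩ := (free_eigenProj n f).exists_isometry fun x =>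
    eigenProj_conjTranspose (f x).1.2
  have key := fun x => exists_adapted_frame (f x).1.2 (hA2 x) (hA1 x)
  refine exists_homeomorph_const f (h := fun x =>
    √2 • fromCols ((A x).map Complex.re) (-(A x).map Complex.im)) ?_ (fun x => (key x).1)
    fun x => (key x).2
  have : Continuous fun x => fromCols ((A x).map Complex.re) (-(A x).map Complex.im) := by
    refine continuous_matrix fun i j => ?_
    rcases j with j | j
    · exact Complex.continuous_re.comp (hA.matrix_elem i j)
    · exact (Complex.continuous_im.comp (hA.matrix_elem i j)).neg
  exact this.const_smul (√2 : ℝ)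

end

end AlmostContact

/-- All path components of the space `C(S^{2n+1}, Γ_{n+1}⁺)` of almost contact
structures on `S^{2n+1}` are homeomorphic. -/
theorem stmt2 (n : ℕ) (hn : 1 ≤ n) (f g : C(Sph (2 * n + 1), GammaPlus (n + 1))) :
    Nonempty (↥(pathComponent f) ≃ₜ ↥(pathComponent g)) := by
  obtain ⟨H, hH⟩ := AlmostContact.exists_homeomorph n f
  obtain ⟨K, hK⟩ := AlmostContact.exists_homeomorph n g
  have h := AlmostContact.nonempty_homeomorph_pathComponent (H.symm.trans K) f
  rwa [Homeomorph.trans_apply, ← hH, Homeomorph.symm_apply_apply, hK, hH] at h
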